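/- Let Φ ∈ 𝔉H and let Σ be a contractive Schur idempotent on B(H). Then the Schur idempotent Ψ = id − (id − Φ)∘Σ (equivalently Ψ = (id − Σ) + Φ∘Σ) belongs to 𝔉H and λ(Ψ) ≤ λ(Φ). -/

import Mathlib

open scoped InnerProductSpace Pointwise

noncomputable section

namespace SchurHyper

/-- `B H` is the algebra of bounded linear operators on `H`. -/
abbrev B (H : Type*) [NormedAddCommGroup H] [InnerProductSpace ℂ H] : Type _ := H →L[ℂ] H

variable (H : Type*) [NormedAddCommGroup H] [InnerProductSpace ℂ H]

/-- A linear functional on `B H` is *normal* (weak* continuous) if it arises from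
the duality with the trace class, i.e. it is of the form
`T ↦ ∑ₙ ⟪yₙ, T xₙ⟫` for square-summable sequences `(xₙ)`, `(yₙ)`
(recall that the inner product is conjugate-linear in its first slot). -/
def IsNormalFunctional (ω : B H →ₗ[ℂ] ℂ) : Prop :=
  ∃ x y : ℕ → H, Summable (fun n => ‖x n‖ ^ 2) ∧ Summable (fun n => ‖y n‖ ^ 2) ∧
    ∀ T : B H, ω T = ∑' n, ⟪y n, T (x n)⟫_ℂ

/-- The weak* topology on `B H`: the topology induced by the normal functionals. -/
def weakStarTopology : TopologicalSpace (B H) :=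
  TopologicalSpace.induced
    (fun (T : B H) (ω : {ω : B H →ₗ[ℂ] ℂ // IsNormalFunctional H ω}) => ω.1 T)
    inferInstance

/-- A set of operators is weak* closed if it is closed in the weak* topology. -/
def WStarClosed (X : Set (B H)) : Prop := @IsClosed _ (weakStarTopology H) X

/-- The weak* closure of a set of operators. -/
def wStarClosure (X : Set (B H)) : Set (B H) := @closure _ (weakStarTopology H) X

/-- A map on `B H` is weak* continuous if it is continuous with respect to the
weak* topology on both sides. -/
def WStarContinuous (Φ : B H →L[ℂ] B H) : Prop :=
  @Continuous _ _ (weakStarTopology H) (weakStarTopology H) Φ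

variable {H}
variable [CompleteSpace H]

/-- A maximal abelian selfadjoint subalgebra of `B H`: an abelian selfadjoint
subalgebra which contains every operator commuting with it (equivalently, it
coincides with its own commutant). -/
def IsMasa (D : StarSubalgebra ℂ (B H)) : Prop :=
  (∀ A ∈ D, ∀ C ∈ D, A * C = C * A) ∧
  (∀ T : B H, (∀ A ∈ D, T * A = A * T) → T ∈ D)

/-- A Schur multiplier: a weak* continuous `D`-bimodule map on `B H`. -/
def IsSchurMultiplier (D : StarSubalgebra ℂ (B H)) (Φ : B H →L[ℂ] B H) : Prop :=
  WStarContinuous H Φ ∧ ∀ A ∈ D, ∀ C ∈ D, ∀ T : B H, Φ (A * T * C) = A * Φ T * C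

/-- A Schur idempotent: an idempotent Schur multiplier. -/
def IsSchurIdempotent (D : StarSubalgebra ℂ (B H)) (Φ : B H →L[ℂ] B H) : Prop :=
  IsSchurMultiplier D Φ ∧ Φ.comp Φ = Φ

/-- A subspace `X ⊆ B H` is a `D`-bimodule if `D X D ⊆ X`. -/
def IsBimodule (D : StarSubalgebra ℂ (B H)) (X : Submodule ℂ (B H)) : Prop :=
  ∀ A ∈ D, ∀ C ∈ D, ∀ T ∈ X, A * T * C ∈ X

/-- The Arveson distance `α(T, X)`. -/
def arveson (T : B H) (X : Set (B H)) : ℝ :=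
  ⨆ ξ : {ξ : H // ‖ξ‖ = 1}, ⨅ S : X, ‖T ξ.1 - S.1 ξ.1‖

/-- The set of hyperreflexivity constants of `X`. -/
def hyperSet (X : Set (B H)) : Set ℝ :=
  {k | 0 < k ∧ ∀ T : B H, Metric.infDist T X ≤ k * arveson T X}

/-- A subspace is hyperreflexive if `d(T, X) ≤ k ⬝ α(T, X)` for some `k > 0`. -/
def Hyperreflexive (X : Set (B H)) : Prop := (hyperSet X).Nonempty

/-- The hyperreflexivity constant `k(X)`: the least constant that works. -/
def hyperConst (X : Set (B H)) : ℝ := sInf (hyperSet X)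

/-- The set of constants `λ` witnessing that a Schur idempotent lies in `𝔉H`. -/
def lamSet (Φ : B H →L[ℂ] B H) : Set ℝ :=
  {l | 0 < l ∧ ∀ T : B H, ‖T - Φ T‖ ≤ l * arveson T (Set.range Φ)}

/-- The class `𝔉H` of Schur idempotents `Φ` such that
`‖T - Φ T‖ ≤ λ ⬝ α(T, ran Φ)` for some `λ > 0` and all `T`. -/
def MemFH (D : StarSubalgebra ℂ (B H)) (Φ : B H →L[ℂ] B H) : Prop :=
  IsSchurIdempotent D Φ ∧ (lamSet Φ).Nonempty

/-- The constant `λ(Φ)`: the least constant witnessing membership of `𝔉H`. -/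
def lam (Φ : B H →L[ℂ] B H) : ℝ := sInf (lamSet Φ)

/-- A ternary masa-bimodule condition: `S T* R ∈ M` whenever `S, T, R ∈ M`. -/
def IsTernary (M : Submodule ℂ (B H)) : Prop :=
  ∀ S ∈ M, ∀ T ∈ M, ∀ R ∈ M, S * star T * R ∈ M

end SchurHyper

open SchurHyper

set_option linter.unusedSectionVars false

open InnerProductSpace (rankOne)
open Filter Topology

namespace SchurHyper

variable {H : Type*} [NormedAddCommGroup H] [InnerProductSpace ℂ H] [CompleteSpace H]
variable {D : StarSubalgebra ℂ (B H)}

/-- The orbit `D v` of a vector. -/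
def orbit (D : StarSubalgebra ℂ (B H)) (v : H) : Submodule ℂ H :=
  D.toSubalgebra.toSubmodule.map (ContinuousLinearMap.apply ℂ H v : B H →ₗ[ℂ] H)

theorem mem_orbit {v z : H} : z ∈ orbit D v ↔ ∃ a ∈ D, a v = z := by
  simp [orbit, Submodule.mem_map]

theorem self_mem_orbit (v : H) : v ∈ orbit D v := mem_orbit.2 ⟨1, one_mem D, rfl⟩

theorem apply_mem_closure_of_forall {K : Submodule ℂ H} {a : B H}
    (h : ∀ v ∈ K, a v ∈ K.topologicalClosure) :
    ∀ v ∈ K.topologicalClosure, a v ∈ K.topologicalClosure := by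
  intro v hv
  have hc : IsClosed (a ⁻¹' (K.topologicalClosure : Set H)) :=
    K.isClosed_topologicalClosure.preimage a.continuous
  exact closure_minimal (s := (K : Set H)) (fun x hx => h x hx) hc hv

theorem apply_mem_closure_orbit {a : B H} (ha : a ∈ D) {v z : H}
    (hz : z ∈ (orbit D v).topologicalClosure) : a z ∈ (orbit D v).topologicalClosure := by
  refine apply_mem_closure_of_forall (fun z hz => ?_) z hz
  obtain ⟨b, hb, rfl⟩ := mem_orbit.1 hz
  exact subset_closure (mem_orbit.2 ⟨a * b, mul_mem ha hb, rfl⟩)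

theorem IsMasa.starProjection_mem (hD : IsMasa D) (K : Submodule ℂ H)
    [K.HasOrthogonalProjection] (hK : ∀ a ∈ D, ∀ v ∈ K, a v ∈ K) : K.starProjection ∈ D := by
  refine hD.2 _ fun a ha => ?_
  ext v
  simp only [mul_apply_eq_comp]
  refine Submodule.eq_starProjection_of_mem_of_inner_eq_zero
    (hK a ha _ (K.starProjection_apply_mem v)) fun w hw => ?_
  rw [← map_sub, ← ContinuousLinearMap.adjoint_inner_right]
  exact K.starProjection_inner_eq_zero v _ (hK _ (star_mem ha) w hw)

/-- The projection onto the closure of `D v`. -/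
def orbitProj (D : StarSubalgebra ℂ (B H)) (v : H) : B H :=
  (orbit D v).topologicalClosure.starProjection

theorem IsMasa.orbitProj_mem (hD : IsMasa D) (v : H) : orbitProj D v ∈ D :=
  hD.starProjection_mem _ fun _ ha _ hz => apply_mem_closure_orbit ha hz

theorem orbitProj_apply_self (v : H) : orbitProj D v v = v :=
  Submodule.starProjection_eq_self_iff.2 (subset_closure (self_mem_orbit v))

theorem eqOn_closure_orbit {S T : B H} {v : H} (h : ∀ a ∈ D, S (a v) = T (a v)) {z : H}
    (hz : z ∈ (orbit D v).topologicalClosure) : S z = T z := by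
  have : Set.EqOn S T (closure (orbit D v : Set H)) := by
    refine Set.EqOn.closure (fun z hz => ?_) S.continuous T.continuous
    obtain ⟨a, ha, rfl⟩ := mem_orbit.1 hz
    exact h a ha
  exact this hz

theorem IsMasa.inner_star_apply (hD : IsMasa D) {a b : B H} (ha : a ∈ D) (hb : b ∈ D) (v : H) :
    ⟪star a v, star b v⟫_ℂ = ⟪b v, a v⟫_ℂ := by
  rw [ContinuousLinearMap.star_eq_adjoint, ContinuousLinearMap.adjoint_inner_left,
    ← mul_apply_eq_comp, hD.1 a ha _ (star_mem hb), mul_apply_eq_comp,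
    ContinuousLinearMap.star_eq_adjoint, ContinuousLinearMap.adjoint_inner_right]

theorem IsMasa.norm_star_apply (hD : IsMasa D) {a : B H} (ha : a ∈ D) (v : H) :
    ‖star a v‖ = ‖a v‖ := by
  have h := hD.inner_star_apply ha ha v
  rw [inner_self_eq_norm_sq_to_K, inner_self_eq_norm_sq_to_K] at h
  have h' : ‖star a v‖ ^ 2 = ‖a v‖ ^ 2 := by exact_mod_cast h
  exact (sq_eq_sq₀ (norm_nonneg _) (norm_nonneg _)).1 h'

theorem mul_rankOne (a : B H) (x y : H) : a * rankOne ℂ x y = rankOne ℂ (a x) y := by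
  ext z; simp

theorem rankOne_mul (b : B H) (x y : H) : rankOne ℂ x y * b = rankOne ℂ x (star b y) := by
  ext z; simp [ContinuousLinearMap.star_eq_adjoint, ContinuousLinearMap.adjoint_inner_left]

theorem norm_sum_rankOne_le {ι : Type*} (s : Finset ι) (x t : ι → H) (ht : Orthonormal ℂ t) :
    ‖∑ i ∈ s, rankOne ℂ (x i) (t i)‖ ≤ √(∑ i ∈ s, ‖x i‖ ^ 2) := by
  refine ContinuousLinearMap.opNorm_le_bound _ (Real.sqrt_nonneg _) fun z => ?_
  rw [sum_apply]
  simp only [InnerProductSpace.rankOne_apply]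
  calc ‖∑ i ∈ s, ⟪t i, z⟫_ℂ • x i‖ ≤ ∑ i ∈ s, ‖x i‖ * ‖⟪t i, z⟫_ℂ‖ := by
        refine (norm_sum_le _ _).trans (Finset.sum_le_sum fun i _ => ?_)
        rw [norm_smul, mul_comm]
    _ ≤ √(∑ i ∈ s, ‖x i‖ ^ 2) * √(∑ i ∈ s, ‖⟪t i, z⟫_ℂ‖ ^ 2) :=
        Real.sum_mul_le_sqrt_mul_sqrt _ _ _
    _ ≤ √(∑ i ∈ s, ‖x i‖ ^ 2) * ‖z‖ := by
        gcongr
        exact Real.sqrt_le_left (norm_nonneg z) |>.2 (ht.sum_inner_products_le z)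

/-- The part of the notion of a contractive Schur idempotent that does not involve the weak*
topology. -/
structure IsContractiveIdem (D : StarSubalgebra ℂ (B H)) (Θ : B H →ₗ[ℂ] B H) : Prop where
  norm_le : ∀ T, ‖Θ T‖ ≤ ‖T‖
  bimod : ∀ a ∈ D, ∀ b ∈ D, ∀ T, Θ (a * T * b) = a * Θ T * b
  idem : ∀ T, Θ (Θ T) = Θ T

namespace IsContractiveIdem

variable {Θ : B H →ₗ[ℂ] B H}

theorem left (h : IsContractiveIdem D Θ) {a : B H} (ha : a ∈ D) (T : B H) :
    Θ (a * T) = a * Θ T := by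
  simpa using h.bimod a ha 1 (one_mem D) T

theorem right (h : IsContractiveIdem D Θ) {b : B H} (hb : b ∈ D) (T : B H) :
    Θ (T * b) = Θ T * b := by
  simpa using h.bimod 1 (one_mem D) b hb T

theorem map_rankOne (h : IsContractiveIdem D Θ) {a b : B H} (ha : a ∈ D) (hb : b ∈ D) (x y : H) :
    Θ (rankOne ℂ (a x) (b y)) = a * Θ (rankOne ℂ x y) * star b := by
  rw [← h.bimod a ha _ (star_mem hb), mul_rankOne, rankOne_mul, star_star]

theorem norm_sum_inner_le (hD : IsMasa D) (h : IsContractiveIdem D Θ) {ι : Type*} (s : Finset ι)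
    (a b : ι → B H) (ha : ∀ i, a i ∈ D) (hb : ∀ i, b i ∈ D) (x y : H)
    (ho : Orthonormal ℂ fun i => b i y) :
    ‖∑ i ∈ s, ⟪a i x, Θ (rankOne ℂ x y) (b i y)⟫_ℂ‖ ≤
      ‖x‖ * ‖y‖ * √(∑ i ∈ s, ‖a i x‖ ^ 2) := by
  have ho' : Orthonormal ℂ fun i => star (b i) y := by
    classical
    rw [orthonormal_iff_ite] at ho ⊢
    intro i j
    rw [hD.inner_star_apply (hb i) (hb j), ho j i]
    simp [eq_comm]
  have key : ∑ i ∈ s, ⟪a i x, Θ (rankOne ℂ x y) (b i y)⟫_ℂ =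
      ⟪x, Θ (∑ i ∈ s, rankOne ℂ (star (a i) x) (star (b i) y)) y⟫_ℂ := by
    rw [map_sum, sum_apply, inner_sum]
    refine Finset.sum_congr rfl fun i _ => ?_
    rw [h.map_rankOne (star_mem (ha i)) (star_mem (hb i)), star_star]
    simp [ContinuousLinearMap.star_eq_adjoint, ContinuousLinearMap.adjoint_inner_right]
  rw [key]
  calc _ ≤ ‖x‖ * (‖Θ (∑ i ∈ s, rankOne ℂ (star (a i) x) (star (b i) y))‖ * ‖y‖) :=
        (norm_inner_le_norm _ _).trans (by gcongr; exact ContinuousLinearMap.le_opNorm _ _)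
    _ ≤ ‖x‖ * (√(∑ i ∈ s, ‖star (a i) x‖ ^ 2) * ‖y‖) := by
        gcongr
        exact (h.norm_le _).trans (norm_sum_rankOne_le s _ _ ho')
    _ = _ := by
        simp only [fun i => hD.norm_star_apply (ha i) x]
        ring

theorem map_rankOne_mem_closure (hD : IsMasa D) (h : IsContractiveIdem D Θ) (x y z : H) :
    Θ (rankOne ℂ x y) z ∈ (orbit D x).topologicalClosure := by
  have := h.left (hD.orbitProj_mem x) (rankOne ℂ x y)
  rw [mul_rankOne, orbitProj_apply_self] at this
  rw [this]
  exact Submodule.starProjection_apply_mem _ _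

theorem map_rankOne_mul_orbitProj (hD : IsMasa D) (h : IsContractiveIdem D Θ) (x y : H) :
    Θ (rankOne ℂ x y) * orbitProj D y = Θ (rankOne ℂ x y) := by
  rw [← h.right (hD.orbitProj_mem y), rankOne_mul]
  congr 2
  have : star (orbitProj D y) = orbitProj D y := isSelfAdjoint_starProjection _
  rw [this, orbitProj_apply_self]

theorem sum_norm_sq_le (hD : IsMasa D) (h : IsContractiveIdem D Θ) {ι : Type*} (s : Finset ι)
    (x y : H) (u : ι → H) (hu : ∀ i, u i ∈ orbit D y) (ho : Orthonormal ℂ u) :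
    ∑ i ∈ s, ‖Θ (rankOne ℂ x y) (u i)‖ ^ 2 ≤ (‖x‖ * ‖y‖) ^ 2 := by
  choose b hb hbu using fun i => mem_orbit.1 (hu i)
  obtain rfl : (fun i => b i y) = u := funext hbu
  set N := Θ (rankOne ℂ x y)
  have hseq : ∀ i, ∃ a : ℕ → B H, (∀ n, a n ∈ D) ∧
      Tendsto (fun n => a n x) atTop (𝓝 (N (b i y))) := by
    intro i
    obtain ⟨z, hz, hlim⟩ := mem_closure_iff_seq_limit.1 (h.map_rankOne_mem_closure hD x y (b i y))
    choose a ha haz using fun n => mem_orbit.1 (hz n)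
    exact ⟨a, ha, by simpa only [haz] using hlim⟩
  choose a ha hlim using hseq
  have h1 : ‖∑ i ∈ s, ⟪N (b i y), N (b i y)⟫_ℂ‖ ≤
      ‖x‖ * ‖y‖ * √(∑ i ∈ s, ‖N (b i y)‖ ^ 2) := by
    refine le_of_tendsto_of_tendsto' (b := atTop)
      (f := fun n => ‖∑ i ∈ s, ⟪a i n x, N (b i y)⟫_ℂ‖)
      (g := fun n => ‖x‖ * ‖y‖ * √(∑ i ∈ s, ‖a i n x‖ ^ 2)) ?_ ?_ fun n => ?_
    · exact (tendsto_finsetSum _ fun i _ => (hlim i).inner tendsto_const_nhds).norm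
    · exact ((tendsto_finsetSum _ fun i _ => (hlim i).norm.pow 2).sqrt).const_mul _
    · exact h.norm_sum_inner_le hD s (fun i => a i n) b (fun i => ha i n) hb x y ho
  have h2 : ‖∑ i ∈ s, ⟪N (b i y), N (b i y)⟫_ℂ‖ = ∑ i ∈ s, ‖N (b i y)‖ ^ 2 := by
    simp only [inner_self_eq_norm_sq_to_K]
    rw [← abs_of_nonneg (Finset.sum_nonneg fun i _ => sq_nonneg ‖N (b i y)‖),
      ← RCLike.norm_ofReal (K := ℂ)]
    push_cast
    rfl
  rw [h2] at h1
  set S := ∑ i ∈ s, ‖N (b i y)‖ ^ 2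
  have hS : 0 ≤ S := Finset.sum_nonneg fun i _ => sq_nonneg _
  have h3 : √S ≤ ‖x‖ * ‖y‖ := by
    by_contra! hlt
    have hpos : 0 < √S := lt_of_le_of_lt (by positivity) hlt
    nlinarith [Real.mul_self_sqrt hS]
  calc S = √S ^ 2 := (Real.sq_sqrt hS).symm
    _ ≤ _ := by gcongr

end IsContractiveIdem
end SchurHyper

namespace SchurHyper
namespace IsContractiveIdem

variable {H : Type*} [NormedAddCommGroup H] [InnerProductSpace ℂ H] [CompleteSpace H]
variable {D : StarSubalgebra ℂ (B H)} {Θ : B H →ₗ[ℂ] B H}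

theorem norm_sq_add_sum_le (hD : IsMasa D) (h : IsContractiveIdem D Θ) {n : ℕ} (x y : H)
    {u : Fin n → H} (hu : ∀ i, u i ∈ orbit D y) (ho : Orthonormal ℂ u) {z : H}
    (hz : z ∈ orbit D y) (hz1 : ‖z‖ = 1) (hzu : ∀ i, ⟪z, u i⟫_ℂ = 0) :
    ‖Θ (rankOne ℂ x y) z‖ ^ 2 + ∑ i, ‖Θ (rankOne ℂ x y) (u i)‖ ^ 2 ≤ (‖x‖ * ‖y‖) ^ 2 := by
  have := h.sum_norm_sq_le hD Finset.univ x y (Matrix.vecCons z u)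
    (Fin.cases hz hu) (orthonormal_vecCons_iff.2 ⟨hz1, hzu, ho⟩)
  simpa [Fin.sum_univ_succ] using this

theorem exists_norm_sub_comp_le (hD : IsMasa D) (h : IsContractiveIdem D Θ) (x y : H) {ε : ℝ}
    (hε : 0 < ε) : ∃ C : B H, IsCompactOperator C ∧ ‖Θ (rankOne ℂ x y) - C‖ ≤ ε := by
  set N := Θ (rankOne ℂ x y) with hN
  set S : Set ℝ := {r | ∃ (n : ℕ) (u : Fin n → H), (∀ i, u i ∈ orbit D y) ∧ Orthonormal ℂ u ∧
    r = ∑ i, ‖N (u i)‖ ^ 2}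
  have hS : BddAbove S := by
    refine ⟨(‖x‖ * ‖y‖) ^ 2, ?_⟩
    rintro _ ⟨n, u, hu, ho, rfl⟩
    exact h.sum_norm_sq_le hD Finset.univ x y u hu ho
  have hne : S.Nonempty := ⟨0, 0, Fin.elim0, fun i => i.elim0, by simp [Orthonormal, Pairwise],
    by simp⟩
  obtain ⟨_, ⟨n, u, hu, ho, rfl⟩, hlt⟩ :=
    exists_lt_of_lt_csSup hne (sub_lt_self (sSup S) (pow_pos hε 2))
  have hsmall : ∀ z ∈ orbit D y, (∀ i, ⟪z, u i⟫_ℂ = 0) → ‖N z‖ ≤ ε * ‖z‖ := by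
    intro z hz hzu
    rcases eq_or_ne z 0 with rfl | hz0
    · simp
    set z' : H := ((‖z‖⁻¹ : ℝ) : ℂ) • z with hz'
    have hzz : z = (‖z‖ : ℂ) • z' := by
      rw [hz', smul_smul, ← Complex.ofReal_mul, mul_inv_cancel₀ (norm_ne_zero_iff.2 hz0)]
      simp
    have hz'1 : ‖z'‖ = 1 := by
      rw [hz', norm_smul, Complex.norm_real, norm_inv, norm_norm,
        inv_mul_cancel₀ (norm_ne_zero_iff.2 hz0)]
    have hmem : ‖N z'‖ ^ 2 + ∑ i, ‖N (u i)‖ ^ 2 ∈ S := by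
      refine ⟨n + 1, Matrix.vecCons z' u, Fin.cases ?_ hu,
        orthonormal_vecCons_iff.2 ⟨hz'1, fun i => ?_, ho⟩, by simp [Fin.sum_univ_succ]⟩
      · rw [hz', inner_smul_left, hzu, mul_zero]
      · exact Submodule.smul_mem _ _ hz
    have h1 : ‖N z'‖ ^ 2 ≤ ε ^ 2 := by linarith [le_csSup hS hmem]
    have h2 : ‖N z'‖ ≤ ε := (sq_le_sq₀ (norm_nonneg _) hε.le).1 h1
    calc ‖N z‖ = ‖z‖ * ‖N z'‖ := by
          conv_lhs => rw [hzz]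
          rw [map_smul, norm_smul, Complex.norm_real, norm_norm]
      _ ≤ ε * ‖z‖ := by rw [mul_comm]; gcongr
  set V := Submodule.span ℂ (Set.range u) with hV
  have : FiniteDimensional ℂ V := FiniteDimensional.span_of_finite ℂ (Set.finite_range u)
  have hVo : V ≤ orbit D y := Submodule.span_le.2 (by rintro _ ⟨i, rfl⟩; exact hu i)
  have hV' : IsCompactOperator V.starProjection := by
    have := FiniteDimensional.proper ℂ V
    have : IsCompactOperator V.orthogonalProjectionOnto :=
      isCompactOperator_of_locallyCompactSpace_dom V.orthogonalProjectionOnto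
    exact this.clm_comp V.subtypeL
  have hclos : ∀ z ∈ (orbit D y).topologicalClosure,
      ‖N z - N (V.starProjection z)‖ ≤ ε * ‖z‖ := by
    intro z hz
    have hc : IsClosed {z | ‖N z - N (V.starProjection z)‖ ≤ ε * ‖z‖} :=
      isClosed_le (by fun_prop) (by fun_prop)
    refine closure_minimal (s := (orbit D y : Set H)) (fun z hz => ?_) hc hz
    have h1 : z - V.starProjection z ∈ orbit D y :=
      Submodule.sub_mem _ hz (hVo (V.starProjection_apply_mem z))
    have h2 := hsmall _ h1 fun i =>
      V.starProjection_inner_eq_zero z _ (Submodule.subset_span ⟨i, rfl⟩)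
    rw [map_sub] at h2
    refine h2.trans ?_
    gcongr
    rw [← V.starProjection_orthogonal_val]
    exact Submodule.norm_starProjection_apply_le _ _
  refine ⟨N * V.starProjection * orbitProj D y,
    (hV'.clm_comp N).comp_clm (orbitProj D y), ?_⟩
  refine ContinuousLinearMap.opNorm_le_bound _ hε.le fun z => ?_
  have h1 : N z = N (orbitProj D y z) := by
    conv_lhs => rw [hN, ← h.map_rankOne_mul_orbitProj hD]
    rfl
  calc ‖(N - N * V.starProjection * orbitProj D y) z‖
      = ‖N (orbitProj D y z) - N (V.starProjection (orbitProj D y z))‖ := by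
        rw [← h1]; rfl
    _ ≤ ε * ‖orbitProj D y z‖ := hclos _ (Submodule.starProjection_apply_mem _ _)
    _ ≤ ε * ‖z‖ := by
        gcongr
        exact Submodule.norm_starProjection_apply_le _ _

theorem isCompactOperator_map_rankOne (hD : IsMasa D) (h : IsContractiveIdem D Θ) (x y : H) :
    IsCompactOperator (Θ (rankOne ℂ x y)) := by
  have hc : IsClosed {T : B H | IsCompactOperator T} := isClosed_setOfPred_isCompactOperator
  refine hc.closure_subset (Metric.mem_closure_iff.2 fun ε hε => ?_)
  obtain ⟨C, hC, hle⟩ := h.exists_norm_sub_comp_le hD x y (half_pos hε)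
  exact ⟨C, hC, by rw [dist_eq_norm]; linarith⟩

theorem map_rankOne_eq_of_apply_eq (hD : IsMasa D) (h : IsContractiveIdem D Θ) {w v : H}
    (hw : ‖w‖ = 1) (hv : ‖v‖ = 1) (hwv : Θ (rankOne ℂ w v) v = w) :
    Θ (rankOne ℂ w v) = rankOne ℂ w v := by
  set N := Θ (rankOne ℂ w v) with hN
  have hzero : ∀ z ∈ orbit D v, ⟪v, z⟫_ℂ = 0 → N z = 0 := by
    intro z hz hvz
    rcases eq_or_ne z 0 with rfl | hz0
    · simp
    have hz1 : ‖((‖z‖⁻¹ : ℝ) : ℂ) • z‖ = 1 := by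
      rw [norm_smul, Complex.norm_real, norm_inv, norm_norm,
        inv_mul_cancel₀ (norm_ne_zero_iff.2 hz0)]
    have hvo : Orthonormal ℂ ![v] := by simp [hv, Orthonormal, Pairwise]
    have := h.norm_sq_add_sum_le hD w v (u := ![v]) (fun i => by simpa using self_mem_orbit v)
      hvo (Submodule.smul_mem _ ((‖z‖⁻¹ : ℝ) : ℂ) hz) hz1 (fun i => by
        simp [inner_eq_zero_symm.1 hvz])
    simp only [← hN, Finset.univ_unique, Finset.sum_singleton, Matrix.cons_val_fin_one, hwv, hw,
      hv] at this
    have h0 : ‖N (((‖z‖⁻¹ : ℝ) : ℂ) • z)‖ ^ 2 ≤ 0 := by linarith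
    have h1 : N (((‖z‖⁻¹ : ℝ) : ℂ) • z) = 0 := by
      rw [← norm_eq_zero]; exact pow_eq_zero_iff two_ne_zero |>.1 (le_antisymm h0 (sq_nonneg _))
    rw [map_smul, smul_eq_zero] at h1
    refine h1.resolve_left ?_
    exact_mod_cast inv_ne_zero (norm_ne_zero_iff.2 hz0)
  have horb : ∀ z ∈ (orbit D v).topologicalClosure, N z = rankOne ℂ w v z := fun z hz => by
    refine eqOn_closure_orbit (fun a ha => ?_) hz
    have hvv : ⟪v, v⟫_ℂ = 1 := by simp [inner_self_eq_norm_sq_to_K, hv]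
    have := hzero (a v - ⟪v, a v⟫_ℂ • v)
      (Submodule.sub_mem _ (mem_orbit.2 ⟨a, ha, rfl⟩) (Submodule.smul_mem _ _ (self_mem_orbit v)))
      (by rw [inner_sub_right, inner_smul_right, hvv, mul_one, sub_self])
    rw [map_sub, map_smul, hwv, sub_eq_zero] at this
    simpa using this
  ext z
  have h1 : N z = N (orbitProj D v z) := by
    conv_lhs => rw [hN, ← h.map_rankOne_mul_orbitProj hD]
    rfl
  rw [h1, horb (orbitProj D v z) (Submodule.starProjection_apply_mem _ _)]
  have h2 : ⟪v, orbitProj D v z⟫_ℂ = ⟪v, z⟫_ℂ := by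
    rw [orbitProj, ← Submodule.inner_starProjection_left_eq_right]
    congr 1
    exact orbitProj_apply_self v
  simp only [InnerProductSpace.rankOne_apply, h2]

end IsContractiveIdem
end SchurHyper

namespace SchurHyper

variable {H : Type*} [NormedAddCommGroup H] [InnerProductSpace ℂ H] [CompleteSpace H]

theorem inner_star_apply_apply (x : B H) (u v : H) : ⟪star x (x u), v⟫_ℂ = ⟪x u, x v⟫_ℂ := by
  rw [ContinuousLinearMap.star_eq_adjoint, ContinuousLinearMap.adjoint_inner_left]

theorem norm_star_apply_sub_sq_le {x : B H} (hx : ‖x‖ ≤ 1) (v : H) :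
    ‖star x (x v) - v‖ ^ 2 ≤ ‖v‖ ^ 2 - ‖x v‖ ^ 2 := by
  have h1 : ‖star x (x v)‖ ≤ ‖x v‖ := by
    refine ((star x).le_of_opNorm_le (c := 1) ?_ (x v)).trans_eq (one_mul _)
    rwa [norm_star]
  rw [@norm_sub_sq ℂ, inner_star_apply_apply]
  have h2 : RCLike.re ⟪x v, x v⟫_ℂ = ‖x v‖ ^ 2 := (norm_sq_eq_re_inner (𝕜 := ℂ) (x v)).symm
  rw [h2]
  nlinarith [norm_nonneg (star x (x v))]

/-- The space of vectors `v` with `x* x v = v`. -/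
def isoSpace (x : B H) : Submodule ℂ H :=
  Module.End.eigenspace (star x * x : B H).toLinearMap 1

theorem mem_isoSpace {x : B H} {v : H} : v ∈ isoSpace x ↔ star x (x v) = v := by
  simp [isoSpace]

theorem norm_apply_of_mem_isoSpace {x : B H} {v : H} (hv : v ∈ isoSpace x) : ‖x v‖ = ‖v‖ := by
  have h := inner_star_apply_apply x v v
  rw [mem_isoSpace.1 hv, inner_self_eq_norm_sq_to_K, inner_self_eq_norm_sq_to_K] at h
  have h' : ‖v‖ ^ 2 = ‖x v‖ ^ 2 := by exact_mod_cast h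
  exact ((sq_eq_sq₀ (norm_nonneg _) (norm_nonneg _)).1 h').symm

theorem mem_isoSpace_of_norm_le {x : B H} (hx : ‖x‖ ≤ 1) {v : H} (hv : ‖v‖ ≤ ‖x v‖) :
    v ∈ isoSpace x := by
  have h := norm_star_apply_sub_sq_le hx v
  have h' : ‖star x (x v) - v‖ ^ 2 ≤ 0 := by nlinarith [norm_nonneg v]
  rw [mem_isoSpace, ← sub_eq_zero, ← norm_eq_zero]
  exact pow_eq_zero_iff two_ne_zero |>.1 (le_antisymm h' (sq_nonneg _))

theorem finiteDimensional_isoSpace {x : B H} (hx : IsCompactOperator x) :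
    FiniteDimensional ℂ (isoSpace x) :=
  ContinuousLinearMap.finite_dimensional_eigenspace (T := star x * x)
    (hx.clm_comp (star x)) 1 one_ne_zero

theorem exists_mem_isoSpace {x : B H} (hx : IsCompactOperator x) (hx1 : ‖x‖ = 1) :
    ∃ v ∈ isoSpace x, ‖v‖ = 1 := by
  have hex : ∀ n : ℕ, ∃ v, ‖v‖ < 1 ∧ 1 - 1 / ((n : ℝ) + 1) < ‖x v‖ := fun n =>
    x.exists_lt_apply_of_lt_opNorm (by rw [hx1]; have : (0 : ℝ) < 1 / (n + 1) := by positivity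
                                       linarith)
  choose v hv1 hv using hex
  have hlim : Tendsto (fun n => ‖x (v n)‖) atTop (𝓝 1) := by
    refine tendsto_of_tendsto_of_tendsto_of_le_of_le (g := fun n : ℕ => 1 - 1 / ((n : ℝ) + 1))
      (h := fun _ => 1) ?_ tendsto_const_nhds (fun n => (hv n).le) fun n => ?_
    · simpa using tendsto_const_nhds.sub (tendsto_one_div_add_atTop_nhds_zero_nat (𝕜 := ℝ))
    · have := x.le_opNorm (v n)
      rw [hx1, one_mul] at this
      exact this.trans (hv1 n).le
  obtain ⟨z, -, φ, hφ, hz⟩ := (hx.isCompact_closure_image_closedBall (f := x.toLinearMap) 1).tendsto_subseq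
    (x := fun n => x (v n)) fun n =>
      subset_closure ⟨v n, by simpa using (hv1 n).le, rfl⟩
  have hsub : Tendsto (fun n => ‖star x (x (v n)) - v n‖) atTop (𝓝 0) := by
    have h0 : Tendsto (fun n => √(1 - ‖x (v n)‖ ^ 2)) atTop (𝓝 0) := by
      have := ((hlim.pow 2).const_sub 1).sqrt
      simpa using this
    refine squeeze_zero (fun _ => norm_nonneg _) (fun n => ?_) h0
    refine Real.le_sqrt_of_sq_le ((norm_star_apply_sub_sq_le hx1.le (v n)).trans ?_)
    have := hv1 n
    gcongr
    nlinarith [norm_nonneg (v n)]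
  have hvlim : Tendsto (fun n => v (φ n)) atTop (𝓝 (star x z)) := by
    have h1 : Tendsto (fun n => star x (x (v (φ n)))) atTop (𝓝 (star x z)) :=
      ((star x).continuous.tendsto z).comp hz
    have h2 := h1.sub (tendsto_zero_iff_norm_tendsto_zero.2 (hsub.comp hφ.tendsto_atTop))
    simpa using h2
  have hxz : x (star x z) = z :=
    tendsto_nhds_unique ((x.continuous.tendsto _).comp hvlim) hz
  have hz1 : ‖z‖ = 1 := tendsto_nhds_unique hz.norm (hlim.comp hφ.tendsto_atTop)
  have hle : ‖star x z‖ ≤ 1 := le_of_tendsto' hvlim.norm fun n => (hv1 _).le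
  have hmem : star x z ∈ isoSpace x := by rw [mem_isoSpace, hxz]
  exact ⟨star x z, hmem, by rw [← norm_apply_of_mem_isoSpace hmem, hxz, hz1]⟩

theorem norm_add_sq_of_mem_isoSpace {x : B H} {p u : H} (hp : p ∈ isoSpace x)
    (hu : u ∈ (isoSpace x)ᗮ) : ‖x (p + u)‖ ^ 2 = ‖p‖ ^ 2 + ‖x u‖ ^ 2 := by
  have h : ⟪x p, x u⟫_ℂ = 0 := by
    rw [← inner_star_apply_apply, mem_isoSpace.1 hp]
    exact hu p hp
  rw [map_add, ← norm_apply_of_mem_isoSpace hp, pow_two, pow_two, pow_two]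
  exact norm_add_sq_eq_norm_sq_add_norm_sq_of_inner_eq_zero _ _ h

theorem exists_gap {x : B H} (hx : IsCompactOperator x) (hx1 : ‖x‖ = 1) :
    ∃ g : ℝ, 0 ≤ g ∧ g < 1 ∧ ∀ u ∈ (isoSpace x)ᗮ, ‖x u‖ ≤ g * ‖u‖ := by
  have := finiteDimensional_isoSpace hx
  set q := (isoSpace x)ᗮ.starProjection with hq
  have hq1 : ∀ z, ‖q z‖ ≤ ‖z‖ := fun z => Submodule.norm_starProjection_apply_le _ _
  have hle : ‖x * q‖ ≤ 1 := by
    refine (norm_mul_le _ _).trans ?_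
    rw [hx1, one_mul]
    exact Submodule.starProjection_norm_le _
  refine ⟨‖x * q‖, norm_nonneg _, lt_of_le_of_ne hle fun h1 => ?_, fun u hu => ?_⟩
  · obtain ⟨v, hv, hv1⟩ := exists_mem_isoSpace (x := x * q) (hx.comp_clm q) h1
    have hn : ‖x (q v)‖ = 1 := by rw [← hv1, ← norm_apply_of_mem_isoSpace hv]; rfl
    have hmem : q v ∈ isoSpace x := mem_isoSpace_of_norm_le hx1.le (by rw [hn, ← hv1]; exact hq1 v)
    have h0 : ⟪q v, q v⟫_ℂ = 0 := (isoSpace x)ᗮ.starProjection_apply_mem v _ hmem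
    rw [inner_self_eq_zero.1 h0] at hn
    simp at hn
  · have := (x * q).le_opNorm u
    rwa [mul_apply_eq_comp, Submodule.starProjection_eq_self_iff.2 hu] at this

end SchurHyper

namespace SchurHyper

variable {H : Type*} [NormedAddCommGroup H] [InnerProductSpace ℂ H] [CompleteSpace H]
variable {D : StarSubalgebra ℂ (B H)} {Θ : B H →ₗ[ℂ] B H}

theorem exists_add_mem_isoSpace {x x' : B H} [FiniteDimensional ℂ (isoSpace x)]
    [FiniteDimensional ℂ (isoSpace x')]
    (hr : Module.finrank ℂ (isoSpace x) ≤ Module.finrank ℂ (isoSpace x')) {g δ : ℝ}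
    (hg : ∀ u ∈ (isoSpace x)ᗮ, ‖x u‖ ≤ g * ‖u‖) (hgδ : g < δ)
    (hδ : ∀ u ∈ isoSpace x', δ * ‖u‖ ≤ ‖x u‖) {v : H} (hv : v ∈ isoSpace x) :
    ∃ k ∈ (isoSpace x)ᗮ, v + k ∈ isoSpace x' := by
  set L : isoSpace x' →ₗ[ℂ] isoSpace x :=
    (isoSpace x).orthogonalProjectionOnto.toLinearMap ∘ₗ (isoSpace x').subtype
  have hL : Function.Injective L := by
    rw [← LinearMap.ker_eq_bot, LinearMap.ker_eq_bot']
    intro u hu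
    have hu' : (u : H) ∈ (isoSpace x)ᗮ :=
      Submodule.orthogonalProjectionOnto_eq_zero_iff.1 hu
    have h1 := hg _ hu'
    have h2 := hδ _ u.2
    have h3 : ‖(u : H)‖ = 0 := by nlinarith [norm_nonneg (u : H)]
    simpa using h3
  have hsurj : Function.Surjective L :=
    (LinearMap.injective_iff_surjective_of_finrank_eq_finrank
      (le_antisymm (LinearMap.finrank_le_finrank_of_injective hL) hr)).1 hL
  obtain ⟨u, hu⟩ := hsurj ⟨v, hv⟩
  have hu' : (isoSpace x).starProjection (u : H) = v := congrArg Subtype.val hu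
  refine ⟨u - v, ?_, by simp⟩
  rw [← hu']
  exact Submodule.sub_starProjection_mem_orthogonal _

theorem norm_sub_real_smul_sq (t : ℝ) (u z : H) :
    ‖u - (t : ℂ) • z‖ ^ 2 = ‖u‖ ^ 2 - 2 * t * RCLike.re ⟪u, z⟫_ℂ + t ^ 2 * ‖z‖ ^ 2 := by
  rw [@norm_sub_sq ℂ, inner_smul_right, norm_smul, Complex.norm_real, mul_pow, Real.norm_eq_abs,
    sq_abs]
  simp
  ring

/-- Norm-one compact operators fixed by `Θ`. -/
structure IsUnitFixed (Θ : B H →ₗ[ℂ] B H) (x : B H) : Prop where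
  isCompactOperator : IsCompactOperator x
  map_eq : Θ x = x
  norm_eq : ‖x‖ = 1

namespace IsContractiveIdem

theorem isUnitFixed_smul_mul (h : IsContractiveIdem D Θ) {x b : B H} (hx : IsUnitFixed Θ x)
    (hb : b ∈ D) (h0 : x * b ≠ 0) : IsUnitFixed Θ (((‖x * b‖⁻¹ : ℝ) : ℂ) • (x * b)) where
  isCompactOperator := (hx.isCompactOperator.comp_clm b).smul ((‖x * b‖⁻¹ : ℝ) : ℂ)
  map_eq := by rw [map_smul, h.right hb, hx.map_eq]
  norm_eq := by
    rw [norm_smul, Complex.norm_real, norm_inv, norm_norm, inv_mul_cancel₀ (norm_ne_zero_iff.2 h0)]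

theorem exists_perturbation (h : IsContractiveIdem D Θ) {x : B H} (hx : IsUnitFixed Θ x)
    (hmin : ∀ x', IsUnitFixed Θ x' →
      Module.finrank ℂ (isoSpace x) ≤ Module.finrank ℂ (isoSpace x'))
    {a : B H} (ha : a ∈ D) {g : ℝ} (hg0 : 0 ≤ g)
    (hg : ∀ u ∈ (isoSpace x)ᗮ, ‖x u‖ ≤ g * ‖u‖) {v : H} (hv : v ∈ isoSpace x) (hv1 : ‖v‖ = 1)
    {t : ℝ} (ht : 0 < t) (htg : g < 1 - 2 * t * ‖a‖) :
    ∃ k : H, (∀ z, ‖(x * (1 - (t : ℂ) • a)) z‖ * ‖v + k‖ ≤ ‖(v + k) - (t : ℂ) • a (v + k)‖ * ‖z‖) ∧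
      (1 - g ^ 2 - 4 * t * ‖a‖) * ‖k‖ ^ 2 ≤ 4 * t * ‖a‖ := by
  set b : B H := 1 - (t : ℂ) • a with hb
  have hbD : b ∈ D := sub_mem (one_mem D) (SMulMemClass.smul_mem _ ha)
  have hM := norm_nonneg a
  have htM : 0 ≤ t * ‖a‖ := by positivity
  have hxle : ∀ z, ‖x z‖ ≤ ‖z‖ := fun z => by simpa [hx.norm_eq] using x.le_opNorm z
  have haz : ∀ z, ‖(t : ℂ) • x (a z)‖ ≤ t * ‖a‖ * ‖z‖ := fun z => by
    rw [norm_smul, Complex.norm_real, Real.norm_eq_abs, abs_of_pos ht, mul_assoc]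
    exact mul_le_mul_of_nonneg_left ((hxle _).trans (a.le_opNorm z)) ht.le
  have hxb : ∀ z, (x * b) z = x z - (t : ℂ) • x (a z) := fun z => by simp [hb]
  have hc : 1 - t * ‖a‖ ≤ ‖x * b‖ := by
    have h1 : ‖x‖ ≤ ‖x * b‖ + t * ‖a‖ := by
      refine x.opNorm_le_bound (by positivity) fun z => ?_
      calc ‖x z‖ = ‖(x * b) z + (t : ℂ) • x (a z)‖ := by rw [hxb, sub_add_cancel]
        _ ≤ ‖x * b‖ * ‖z‖ + t * ‖a‖ * ‖z‖ :=
          (norm_add_le _ _).trans (add_le_add ((x * b).le_opNorm z) (haz z))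
        _ = _ := by ring
    rw [hx.norm_eq] at h1
    linarith
  have hcpos : 0 < ‖x * b‖ := by nlinarith
  have hx' := h.isUnitFixed_smul_mul hx hbD (norm_pos_iff.1 hcpos)
  set x' := ((‖x * b‖⁻¹ : ℝ) : ℂ) • (x * b) with hx'def
  have := finiteDimensional_isoSpace hx.isCompactOperator
  have := finiteDimensional_isoSpace hx'.isCompactOperator
  have hx'u : ∀ u ∈ isoSpace x', ‖(x * b) u‖ = ‖x * b‖ * ‖u‖ := fun u hu => by
    rw [← norm_apply_of_mem_isoSpace hu, hx'def, smul_apply, norm_smul,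
      Complex.norm_real, norm_inv, norm_norm, mul_inv_cancel_left₀ hcpos.ne']
  have hlow : ∀ u ∈ isoSpace x', (1 - 2 * t * ‖a‖) * ‖u‖ ≤ ‖x u‖ := fun u hu => by
    have h1 : ‖(x * b) u‖ ≤ ‖x u‖ + t * ‖a‖ * ‖u‖ := by
      rw [hxb]
      exact (norm_sub_le _ _).trans (add_le_add le_rfl (haz u))
    rw [hx'u u hu] at h1
    nlinarith [norm_nonneg u]
  obtain ⟨k, hk, hvk⟩ := exists_add_mem_isoSpace (hmin _ hx') hg htg hlow hv
  refine ⟨k, fun z => ?_, ?_⟩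
  · calc ‖(x * b) z‖ * ‖v + k‖ ≤ ‖x * b‖ * ‖z‖ * ‖v + k‖ := by
          gcongr; exact (x * b).le_opNorm z
      _ = ‖(x * b) (v + k)‖ * ‖z‖ := by rw [hx'u _ hvk]; ring
      _ ≤ _ := by
          gcongr
          refine (hxle (b (v + k))).trans_eq ?_
          simp [hb]
  · have h1 := norm_add_sq_of_mem_isoSpace hv hk
    have h2 : ‖v + k‖ ^ 2 = 1 + ‖k‖ ^ 2 := by
      rw [pow_two, norm_add_sq_eq_norm_sq_add_norm_sq_of_inner_eq_zero (𝕜 := ℂ) _ _ (hk v hv), hv1]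
      ring
    have h3 := hlow _ hvk
    have h4 : ((1 - 2 * t * ‖a‖) * ‖v + k‖) ^ 2 ≤ ‖x (v + k)‖ ^ 2 := by
      have : 0 ≤ 1 - 2 * t * ‖a‖ := hg0.trans htg.le
      gcongr
    have h5 : ‖x k‖ ^ 2 ≤ (g * ‖k‖) ^ 2 := by
      gcongr
      exact hg k hk
    rw [mul_pow, h2, h1, hv1] at h4
    nlinarith [sq_nonneg ‖k‖, mul_nonneg (sq_nonneg (t * ‖a‖)) (sq_nonneg ‖k‖),
      sq_nonneg (t * ‖a‖)]

theorem re_inner_le (h : IsContractiveIdem D Θ) {x : B H} (hx : IsUnitFixed Θ x)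
    (hmin : ∀ x', IsUnitFixed Θ x' →
      Module.finrank ℂ (isoSpace x) ≤ Module.finrank ℂ (isoSpace x'))
    {a : B H} (ha : a ∈ D) {v v' : H} (hv : v ∈ isoSpace x)
    (hv1 : ‖v‖ = 1) (hv' : v' ∈ isoSpace x) (hv1' : ‖v'‖ = 1) :
    RCLike.re ⟪v, a v⟫_ℂ ≤ RCLike.re ⟪v', a v'⟫_ℂ := by
  obtain ⟨g, hg0, hg1, hg⟩ := exists_gap hx.isCompactOperator hx.norm_eq
  have hsmall : ∀ᶠ t : ℝ in 𝓝[>] 0, g < 1 - 2 * t * ‖a‖ ∧ 0 < 1 - g ^ 2 - 4 * t * ‖a‖ ∧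
      0 < 1 - t * RCLike.re ⟪v', a v'⟫_ℂ := by
    refine Eventually.filter_mono nhdsWithin_le_nhds ?_
    refine (ContinuousAt.eventually_lt (by fun_prop) (by fun_prop) (by simpa using hg1)).and
      ((ContinuousAt.eventually_lt (by fun_prop) (by fun_prop) ?_).and
        (ContinuousAt.eventually_lt (by fun_prop) (by fun_prop) (by simp)))
    simp only [mul_zero, zero_mul]
    nlinarith
  have hex : ∀ᶠ t : ℝ in 𝓝[>] 0, ∃ k : H,
      (∀ z, ‖(x * (1 - (t : ℂ) • a)) z‖ * ‖v + k‖ ≤ ‖(v + k) - (t : ℂ) • a (v + k)‖ * ‖z‖) ∧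
      (1 - g ^ 2 - 4 * t * ‖a‖) * ‖k‖ ^ 2 ≤ 4 * t * ‖a‖ := by
    filter_upwards [hsmall, self_mem_nhdsWithin] with t ht ht0
    exact h.exists_perturbation hx hmin ha hg0 hg hv hv1 ht0 ht.1
  obtain ⟨k, hk⟩ := hex.choice
  have hk0 : Tendsto k (𝓝[>] 0) (𝓝 0) := by
    have h0 : Tendsto (fun t : ℝ => √(4 * t * ‖a‖ / (1 - g ^ 2 - 4 * t * ‖a‖))) (𝓝[>] 0) (𝓝 0) := by
      have hne : 1 - g ^ 2 - 4 * (0 : ℝ) * ‖a‖ ≠ 0 := by nlinarith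
      have hc : ContinuousAt (fun t : ℝ => √(4 * t * ‖a‖ / (1 - g ^ 2 - 4 * t * ‖a‖))) 0 := by
        fun_prop (disch := exact hne)
      have := hc.tendsto
      simp only [mul_zero, zero_mul, zero_div, Real.sqrt_zero] at this
      exact this.mono_left nhdsWithin_le_nhds
    refine squeeze_zero_norm' ?_ h0
    filter_upwards [hk, hsmall] with t hkt ht
    refine Real.le_sqrt_of_sq_le ((le_div_iff₀ ht.2.1).2 ?_)
    rw [mul_comm]
    exact hkt.2
  have hu : Tendsto (fun t => v + k t) (𝓝[>] 0) (𝓝 v) := by simpa using hk0.const_add v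
  have hineq : ∀ᶠ t : ℝ in 𝓝[>] 0, 2 * RCLike.re ⟪v + k t, a (v + k t)⟫_ℂ ≤
      2 * RCLike.re ⟪v', a v'⟫_ℂ * ‖v + k t‖ ^ 2 + t * ‖a (v + k t)‖ ^ 2 := by
    filter_upwards [hk, hsmall, self_mem_nhdsWithin] with t hkt ht ht0
    have ht0 : 0 < t := ht0
    set u := v + k t
    set r := RCLike.re ⟪v', a v'⟫_ℂ with hr
    have h1 : 1 - t * r ≤ ‖(x * (1 - (t : ℂ) • a)) v'‖ := by
      have h2 : RCLike.re ⟪x v', (x * (1 - (t : ℂ) • a)) v'⟫_ℂ = 1 - t * r := by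
        rw [mul_apply_eq_comp, ← inner_star_apply_apply, mem_isoSpace.1 hv']
        simp [inner_self_eq_norm_sq_to_K, hv1', hr]
      rw [← h2]
      refine (re_inner_le_norm _ _).trans_eq ?_
      rw [norm_apply_of_mem_isoSpace hv', hv1', one_mul]
    have h3 : (1 - t * r) * ‖u‖ ≤ ‖u - (t : ℂ) • a u‖ := by
      have := hkt.1 v'
      rw [hv1', mul_one] at this
      exact le_trans (by gcongr) this
    have h4 : ((1 - t * r) * ‖u‖) ^ 2 ≤ ‖u - (t : ℂ) • a u‖ ^ 2 := by
      have := ht.2.2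
      gcongr
    rw [norm_sub_real_smul_sq, mul_pow] at h4
    refine le_of_mul_le_mul_left ?_ ht0
    nlinarith [mul_nonneg (sq_nonneg (t * r)) (sq_nonneg ‖u‖)]
  have hl : Tendsto (fun t => 2 * RCLike.re ⟪v + k t, a (v + k t)⟫_ℂ) (𝓝[>] 0)
      (𝓝 (2 * RCLike.re ⟪v, a v⟫_ℂ)) :=
    ((RCLike.continuous_re.tendsto _).comp
      (hu.inner ((a.continuous.tendsto v).comp hu))).const_mul 2
  have hr : Tendsto (fun t => 2 * RCLike.re ⟪v', a v'⟫_ℂ * ‖v + k t‖ ^ 2 +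
      t * ‖a (v + k t)‖ ^ 2) (𝓝[>] 0) (𝓝 (2 * RCLike.re ⟪v', a v'⟫_ℂ * ‖v‖ ^ 2 + 0 * ‖a v‖ ^ 2)) :=
    ((hu.norm.pow 2).const_mul _).add
      ((tendsto_id.mono_left nhdsWithin_le_nhds).mul (((a.continuous.tendsto v).comp hu).norm.pow 2))
  have := le_of_tendsto_of_tendsto hl hr hineq
  rw [hv1] at this
  linarith

end IsContractiveIdem
end SchurHyper

namespace SchurHyper

variable {H : Type*} [NormedAddCommGroup H] [InnerProductSpace ℂ H] [CompleteSpace H]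
variable {D : StarSubalgebra ℂ (B H)} {Θ : B H →ₗ[ℂ] B H}

theorem exists_isUnitFixed_minimal (h : ∃ x, IsUnitFixed Θ x) :
    ∃ x, IsUnitFixed Θ x ∧ ∀ x', IsUnitFixed Θ x' →
      Module.finrank ℂ (isoSpace x) ≤ Module.finrank ℂ (isoSpace x') := by
  set S : Set ℕ := {n | ∃ x, IsUnitFixed Θ x ∧ Module.finrank ℂ (isoSpace x) = n}
  have hS : S.Nonempty := by
    obtain ⟨x, hx⟩ := h
    exact ⟨_, x, hx, rfl⟩
  obtain ⟨x, hx, hxn⟩ := Nat.sInf_mem hS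
  exact ⟨x, hx, fun x' hx' => hxn.trans_le (Nat.sInf_le ⟨x', hx', rfl⟩)⟩

namespace IsContractiveIdem

theorem inner_eq (h : IsContractiveIdem D Θ) {x : B H} (hx : IsUnitFixed Θ x)
    (hmin : ∀ x', IsUnitFixed Θ x' →
      Module.finrank ℂ (isoSpace x) ≤ Module.finrank ℂ (isoSpace x'))
    {a : B H} (ha : a ∈ D) {v v' : H} (hv : v ∈ isoSpace x)
    (hv1 : ‖v‖ = 1) (hv' : v' ∈ isoSpace x) (hv1' : ‖v'‖ = 1) :
    ⟪v, a v⟫_ℂ = ⟪v', a v'⟫_ℂ := by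
  have hre : ∀ b ∈ D, RCLike.re ⟪v, b v⟫_ℂ = RCLike.re ⟪v', b v'⟫_ℂ := fun b hb =>
    le_antisymm (h.re_inner_le hx hmin hb hv hv1 hv' hv1') (h.re_inner_le hx hmin hb hv' hv1' hv hv1)
  have him := hre (Complex.I • a) (SMulMemClass.smul_mem _ ha)
  refine Complex.ext (hre a ha) ?_
  simpa [inner_smul_right] using him

theorem inner_eq_mul (h : IsContractiveIdem D Θ) {x : B H} (hx : IsUnitFixed Θ x)
    (hmin : ∀ x', IsUnitFixed Θ x' →
      Module.finrank ℂ (isoSpace x) ≤ Module.finrank ℂ (isoSpace x'))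
    {a : B H} (ha : a ∈ D) {v v₁ v₂ : H} (hv : v ∈ isoSpace x) (hv1 : ‖v‖ = 1)
    (h₁ : v₁ ∈ isoSpace x) (h₂ : v₂ ∈ isoSpace x) :
    ⟪v₂, a v₁⟫_ℂ = ⟪v, a v⟫_ℂ * ⟪v₂, v₁⟫_ℂ := by
  have := finiteDimensional_isoSpace hx.isCompactOperator
  set c := ⟪v, a v⟫_ℂ
  set T : isoSpace x →ₗ[ℂ] isoSpace x :=
    (isoSpace x).orthogonalProjectionOnto.toLinearMap ∘ₗ a.toLinearMap ∘ₗ (isoSpace x).subtype -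
      c • LinearMap.id with hTdef
  have hT : ∀ z w : isoSpace x, ⟪w, T z⟫_ℂ = ⟪(w : H), a z⟫_ℂ - c * ⟪(w : H), z⟫_ℂ := by
    intro z w
    simp [hTdef]
  have hT0 : T = 0 := by
    refine (inner_map_self_eq_zero T).1 fun z => ?_
    rw [← inner_conj_symm, hT]
    rcases eq_or_ne (z : H) 0 with h0 | h0
    · simp [h0]
    have hz1 : ‖((‖(z : H)‖⁻¹ : ℝ) : ℂ) • (z : H)‖ = 1 := by
      rw [norm_smul, Complex.norm_real, norm_inv, norm_norm,
        inv_mul_cancel₀ (norm_ne_zero_iff.2 h0)]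
    have := h.inner_eq hx hmin ha hv hv1 (Submodule.smul_mem _ _ z.2) hz1
    rw [map_smul, inner_smul_left, inner_smul_right, Complex.conj_ofReal] at this
    have hne : ((‖(z : H)‖ : ℝ) : ℂ) ≠ 0 := by exact_mod_cast norm_ne_zero_iff.2 h0
    rw [inner_self_eq_norm_sq_to_K, show c = _ from this]
    push_cast
    field_simp
    simp
  have := hT ⟨v₁, h₁⟩ ⟨v₂, h₂⟩
  rw [hT0, LinearMap.zero_apply, inner_zero_right] at this
  exact sub_eq_zero.1 this.symm

theorem eq_zero_of_inner_eq_zero (hD : IsMasa D) (h : IsContractiveIdem D Θ) {x : B H}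
    (hx : IsUnitFixed Θ x)
    (hmin : ∀ x', IsUnitFixed Θ x' →
      Module.finrank ℂ (isoSpace x) ≤ Module.finrank ℂ (isoSpace x'))
    {v z : H} (hv : v ∈ isoSpace x) (hv1 : ‖v‖ = 1) (hz : z ∈ isoSpace x) (hvz : ⟪v, z⟫_ℂ = 0) :
    z = 0 := by
  have hvv : ⟪v, v⟫_ℂ = 1 := by simp [inner_self_eq_norm_sq_to_K, hv1]
  have hzv : ⟪z, v⟫_ℂ = 0 := inner_eq_zero_symm.1 hvz
  have hle : (orbit D v).topologicalClosure ≤ (ℂ ∙ z)ᗮ := by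
    refine Submodule.topologicalClosure_minimal _ (fun w hw => ?_)
      (Submodule.isClosed_orthogonal _)
    obtain ⟨a, ha, rfl⟩ := mem_orbit.1 hw
    rw [Submodule.mem_orthogonal_singleton_iff_inner_right,
      h.inner_eq_mul hx hmin ha hv hv1 hv hz, hzv, mul_zero]
  have h1 : ⟪z, orbitProj D v z⟫_ℂ = 0 :=
    Submodule.mem_orthogonal_singleton_iff_inner_right.1
      (hle (Submodule.starProjection_apply_mem _ _))
  rw [h.inner_eq_mul hx hmin (hD.orbitProj_mem v) hv hv1 hz hz, orbitProj_apply_self, hvv,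
    one_mul] at h1
  exact inner_self_eq_zero.1 h1

theorem exists_fixed_rankOne (hD : IsMasa D) (h : IsContractiveIdem D Θ) {x₀ y₀ : H}
    (h0 : Θ (rankOne ℂ x₀ y₀) ≠ 0) :
    ∃ w v : H, ‖w‖ = 1 ∧ ‖v‖ = 1 ∧ Θ (rankOne ℂ w v) = rankOne ℂ w v := by
  obtain ⟨x, hx, hmin⟩ : ∃ x, IsUnitFixed Θ x ∧ ∀ x', IsUnitFixed Θ x' →
      Module.finrank ℂ (isoSpace x) ≤ Module.finrank ℂ (isoSpace x') := by
    refine exists_isUnitFixed_minimal ⟨((‖Θ (rankOne ℂ x₀ y₀)‖⁻¹ : ℝ) : ℂ) • Θ (rankOne ℂ x₀ y₀),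
      (h.isCompactOperator_map_rankOne hD x₀ y₀).smul _, by rw [map_smul, h.idem], ?_⟩
    rw [norm_smul, Complex.norm_real, norm_inv, norm_norm, inv_mul_cancel₀ (norm_ne_zero_iff.2 h0)]
  obtain ⟨v, hv, hv1⟩ := exists_mem_isoSpace hx.isCompactOperator hx.norm_eq
  obtain ⟨g, hg0, hg1, hg⟩ := exists_gap hx.isCompactOperator hx.norm_eq
  have hvv : ⟪v, v⟫_ℂ = 1 := by simp [inner_self_eq_norm_sq_to_K, hv1]
  have hspan : ∀ p ∈ isoSpace x, p = ⟪v, p⟫_ℂ • v := fun p hp => by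
    rw [← sub_eq_zero]
    exact h.eq_zero_of_inner_eq_zero hD hx hmin hv hv1
      (Submodule.sub_mem _ hp (Submodule.smul_mem _ _ hv))
      (by rw [inner_sub_right, inner_smul_right, hvv, mul_one, sub_self])
  have hw1 : ‖x v‖ = 1 := by rw [norm_apply_of_mem_isoSpace hv, hv1]
  have hnorm : ‖x - ((1 - g : ℝ) : ℂ) • rankOne ℂ (x v) v‖ ≤ g := by
    refine ContinuousLinearMap.opNorm_le_bound _ hg0 fun z => ?_
    set u := z - ⟪v, z⟫_ℂ • v with hu
    have hvu : ⟪v, u⟫_ℂ = 0 := by rw [hu, inner_sub_right, inner_smul_right, hvv, mul_one, sub_self]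
    have huV : u ∈ (isoSpace x)ᗮ := fun p hp => by
      rw [hspan p hp, inner_smul_left, hvu, mul_zero]
    have hz : z = ⟪v, z⟫_ℂ • v + u := by rw [hu]; abel
    have hznorm : ‖z‖ ^ 2 = ‖⟪v, z⟫_ℂ‖ ^ 2 + ‖u‖ ^ 2 := by
      conv_lhs => rw [hz]
      rw [pow_two, norm_add_sq_eq_norm_sq_add_norm_sq_of_inner_eq_zero (𝕜 := ℂ) _ _
        (by rw [inner_smul_left, hvu, mul_zero]), norm_smul, hv1]
      ring
    have hap : (x - ((1 - g : ℝ) : ℂ) • rankOne ℂ (x v) v) z =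
        x (((g : ℂ) * ⟪v, z⟫_ℂ) • v + u) := by
      rw [sub_apply, smul_apply, InnerProductSpace.rankOne_apply, map_add, map_smul]
      have hxz : x z = ⟪v, z⟫_ℂ • x v + x u := by rw [← map_smul, ← map_add, ← hz]
      rw [hxz, smul_smul]
      push_cast
      module
    have h1 := norm_add_sq_of_mem_isoSpace (Submodule.smul_mem _ ((g : ℂ) * ⟪v, z⟫_ℂ) hv) huV
    rw [norm_smul, hv1, mul_one, norm_mul, Complex.norm_real, Real.norm_eq_abs,
      abs_of_nonneg hg0] at h1
    have h2 : ‖x u‖ ^ 2 ≤ (g * ‖u‖) ^ 2 := by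
      gcongr
      exact hg u huV
    rw [hap, ← sq_le_sq₀ (norm_nonneg _) (by positivity), h1, mul_pow g ‖z‖, hznorm]
    linarith [mul_pow g ‖u‖ 2, mul_pow g ‖⟪v, z⟫_ℂ‖ 2]
  refine ⟨x v, v, hw1, hv1, h.map_rankOne_eq_of_apply_eq hD hw1 hv1 ?_⟩
  set N := Θ (rankOne ℂ (x v) v) with hN
  have hle : ‖x - ((1 - g : ℝ) : ℂ) • N‖ ≤ g := by
    have := h.norm_le (x - ((1 - g : ℝ) : ℂ) • rankOne ℂ (x v) v)
    rw [map_sub, map_smul, hx.map_eq] at this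
    exact this.trans hnorm
  have hNv : ‖N v‖ ≤ 1 := by
    refine (N.le_opNorm v).trans ?_
    rw [hv1, mul_one]
    refine (h.norm_le _).trans ?_
    rw [InnerProductSpace.norm_rankOne, hw1, hv1, one_mul]
  have hre : 1 - (1 - g) * RCLike.re ⟪x v, N v⟫_ℂ ≤ g := by
    have h1 : RCLike.re ⟪x v, (x - ((1 - g : ℝ) : ℂ) • N) v⟫_ℂ =
        1 - (1 - g) * RCLike.re ⟪x v, N v⟫_ℂ := by
      rw [sub_apply, smul_apply, inner_sub_right, inner_smul_right, inner_self_eq_norm_sq_to_K, hw1]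
      simp
    rw [← h1]
    refine (re_inner_le_norm _ _).trans ?_
    rw [hw1, one_mul]
    refine (ContinuousLinearMap.le_opNorm _ _).trans ?_
    rwa [hv1, mul_one]
  have hre' : 1 ≤ RCLike.re ⟪x v, N v⟫_ℂ := by
    have : 0 < 1 - g := by linarith
    nlinarith
  have h0 : ‖N v - x v‖ ^ 2 ≤ 0 := by
    rw [norm_sub_rev, @norm_sub_sq ℂ, hw1]
    nlinarith [norm_nonneg (N v)]
  rw [← sub_eq_zero, ← norm_eq_zero]
  exact pow_eq_zero_iff two_ne_zero |>.1 (le_antisymm h0 (sq_nonneg _))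

end IsContractiveIdem
end SchurHyper

namespace SchurHyper

variable {H : Type*} [NormedAddCommGroup H] [InnerProductSpace ℂ H]

theorem isNormalFunctional_inner (u v : H) :
    IsNormalFunctional H ((innerSL ℂ u).toLinearMap ∘ₗ
      (ContinuousLinearMap.apply ℂ H v : B H →L[ℂ] H).toLinearMap) := by
  refine ⟨Pi.single 0 v, Pi.single 0 u, summable_of_ne_finset_zero (s := {0}) fun n hn => ?_,
    summable_of_ne_finset_zero (s := {0}) fun n hn => ?_, fun T => ?_⟩
  · simp [Pi.single_eq_of_ne (Finset.notMem_singleton.1 hn)]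
  · simp [Pi.single_eq_of_ne (Finset.notMem_singleton.1 hn)]
  · rw [tsum_eq_single 0 fun n hn => by simp [Pi.single_eq_of_ne hn]]
    simp

theorem continuous_normalFunctional {ω : B H →ₗ[ℂ] ℂ} (hω : IsNormalFunctional H ω) :
    Continuous[weakStarTopology H, inferInstance] ω := by
  have h := @continuous_induced_dom _ _
    (fun (T : B H) (ω : {ω : B H →ₗ[ℂ] ℂ // IsNormalFunctional H ω}) => ω.1 T) inferInstance
  exact @Continuous.comp _ _ _ (weakStarTopology H) _ _ _
    (fun p : {ω : B H →ₗ[ℂ] ℂ // IsNormalFunctional H ω} → ℂ => p ⟨ω, hω⟩)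
    (continuous_apply (⟨ω, hω⟩ : {ω : B H →ₗ[ℂ] ℂ // IsNormalFunctional H ω})) h

theorem wStarContinuous_iff {Φ : B H →L[ℂ] B H} : WStarContinuous H Φ ↔
    ∀ ω : B H →ₗ[ℂ] ℂ, IsNormalFunctional H ω →
      Continuous[weakStarTopology H, inferInstance] fun T => ω (Φ T) := by
  constructor
  · intro h ω hω
    exact @Continuous.comp _ _ _ (weakStarTopology H) (weakStarTopology H) _ _ _
      (continuous_normalFunctional hω) h
  · intro h
    refine continuous_induced_rng.2 ?_
    exact @continuous_pi _ _ _ (weakStarTopology H) _ _ fun ω => h ω.1 ω.2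

theorem wStarContinuous_id : WStarContinuous H (ContinuousLinearMap.id ℂ (B H)) :=
  @continuous_id _ (weakStarTopology H)

theorem WStarContinuous.comp {Φ Ψ : B H →L[ℂ] B H} (hΦ : WStarContinuous H Φ)
    (hΨ : WStarContinuous H Ψ) : WStarContinuous H (Φ.comp Ψ) :=
  @Continuous.comp _ _ _ (weakStarTopology H) (weakStarTopology H) (weakStarTopology H) Ψ Φ hΦ hΨ

theorem WStarContinuous.sub {Φ Ψ : B H →L[ℂ] B H} (hΦ : WStarContinuous H Φ)
    (hΨ : WStarContinuous H Ψ) : WStarContinuous H (Φ - Ψ) := by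
  refine wStarContinuous_iff.2 fun ω hω => ?_
  have h := @Continuous.sub ℂ _ (weakStarTopology H) _ _ _ _ _
    (wStarContinuous_iff.1 hΦ ω hω) (wStarContinuous_iff.1 hΨ ω hω)
  have heq : (fun T => ω ((Φ - Ψ) T)) = (fun T => ω (Φ T)) - fun T => ω (Ψ T) := by
    ext T; simp
  rw [heq]
  exact h

variable [CompleteSpace H]

theorem norm_sum_inner_smul_le {ι : Type*} {b : ι → H} (hb : Orthonormal ℂ b) (s : Finset ι)
    (x : H) : ‖∑ i ∈ s, ⟪b i, x⟫_ℂ • b i‖ ≤ ‖x‖ := by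
  refine (sq_le_sq₀ (norm_nonneg _) (norm_nonneg _)).1 ?_
  refine le_of_eq_of_le ?_ (hb.sum_inner_products_le x (s := s))
  rw [@norm_sq_eq_re_inner ℂ, hb.inner_sum, map_sum]
  refine Finset.sum_congr rfl fun i _ => ?_
  rw [RCLike.conj_mul]
  norm_cast

theorem tendsto_normalFunctional {ι : Type*} (b : HilbertBasis ι ℂ H) (T : B H)
    {ω : B H →ₗ[ℂ] ℂ} (hω : IsNormalFunctional H ω) :
    Tendsto (fun s : Finset ι => ω (∑ i ∈ s, rankOne ℂ (T (b i)) (b i))) atTop (𝓝 (ω T)) := by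
  obtain ⟨x, y, hx, hy, hxy⟩ := hω
  have happ : ∀ (s : Finset ι) (z : H), (∑ i ∈ s, rankOne ℂ (T (b i)) (b i)) z =
      T (∑ i ∈ s, ⟪b i, z⟫_ℂ • b i) := fun s z => by
    simp [sum_apply, map_sum]
  simp only [hxy, happ]
  refine tendsto_tsum_of_dominated_convergence
    (bound := fun n => ‖T‖ * (‖x n‖ ^ 2 + ‖y n‖ ^ 2)) ((hx.add hy).mul_left _)
    (fun n => ?_) (Eventually.of_forall fun s n => ?_)
  · have h1 := b.hasSum_repr (x n)
    simp only [b.repr_apply_apply] at h1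
    exact tendsto_const_nhds.inner ((T.continuous.tendsto _).comp h1)
  · calc _ ≤ ‖y n‖ * (‖T‖ * ‖x n‖) := by
          refine (norm_inner_le_norm _ _).trans ?_
          gcongr
          refine (T.le_opNorm _).trans ?_
          gcongr
          exact norm_sum_inner_smul_le b.orthonormal s _
      _ = ‖T‖ * (‖y n‖ * ‖x n‖) := by ring
      _ ≤ _ := by
          gcongr
          nlinarith [sq_nonneg (‖x n‖ - ‖y n‖), sq_nonneg ‖x n‖, sq_nonneg ‖y n‖]

theorem WStarContinuous.tendsto_inner {Φ : B H →L[ℂ] B H} (hΦ : WStarContinuous H Φ) {ι : Type*}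
    (b : HilbertBasis ι ℂ H) (T : B H) (u v : H) :
    Tendsto (fun s : Finset ι => ⟪u, Φ (∑ i ∈ s, rankOne ℂ (T (b i)) (b i)) v⟫_ℂ) atTop
      (𝓝 ⟪u, Φ T v⟫_ℂ) := by
  have h1 := wStarContinuous_iff.1 hΦ _ (isNormalFunctional_inner u v)
  have h2 : Tendsto (fun s : Finset ι => ∑ i ∈ s, rankOne ℂ (T (b i)) (b i)) atTop
      (@nhds _ (weakStarTopology H) T) := by
    rw [weakStarTopology, nhds_induced, tendsto_comap_iff]
    exact tendsto_pi_nhds.2 fun ω => tendsto_normalFunctional b T ω.2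
  exact (@Continuous.tendsto _ _ (weakStarTopology H) _ _ h1 T).comp h2

/-- Identities between weak* continuous maps may be checked on rank one operators. -/
theorem WStarContinuous.mul_mul_eq {Φ : B H →L[ℂ] B H} (hΦ : WStarContinuous H Φ)
    {C E C' E' : B H} (h : ∀ x y, C * Φ (rankOne ℂ x y) * E = C' * rankOne ℂ x y * E') (T : B H) :
    C * Φ T * E = C' * T * E' := by
  obtain ⟨w, b, -⟩ := exists_hilbertBasis ℂ H
  have hinner : ∀ (A G S : B H) (u v : H), ⟪u, (A * S * G) v⟫_ℂ = ⟪star A u, S (G v)⟫_ℂ :=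
    fun A G S u v => by
      rw [ContinuousLinearMap.star_eq_adjoint, ContinuousLinearMap.adjoint_inner_left]; rfl
  ext v
  refine ext_inner_left ℂ fun u => ?_
  rw [hinner, hinner]
  refine tendsto_nhds_unique (hΦ.tendsto_inner b T (star C u) (E v)) ?_
  refine (wStarContinuous_id.tendsto_inner b T (star C' u) (E' v)).congr fun s => ?_
  rw [← hinner, ← hinner]
  simp only [map_sum, Finset.mul_sum, Finset.sum_mul, h, ContinuousLinearMap.id_apply]

end SchurHyper

namespace SchurHyper

variable {H : Type*} [NormedAddCommGroup H] [InnerProductSpace ℂ H] [CompleteSpace H]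
variable {D : StarSubalgebra ℂ (B H)} {Sig : B H →L[ℂ] B H}

theorem IsSchurIdempotent.apply_apply (hS : IsSchurIdempotent D Sig) (T : B H) :
    Sig (Sig T) = Sig T := DFunLike.congr_fun hS.2 T

theorem IsSchurIdempotent.map_mul_left (hS : IsSchurIdempotent D Sig) {a : B H} (ha : a ∈ D)
    (T : B H) : Sig (a * T) = a * Sig T := by
  simpa using hS.1.2 a ha 1 (one_mem D) T

theorem IsSchurIdempotent.map_mul_right (hS : IsSchurIdempotent D Sig) {b : B H} (hb : b ∈ D)
    (T : B H) : Sig (T * b) = Sig T * b := by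
  simpa using hS.1.2 1 (one_mem D) b hb T

/-- The compression `T ↦ p Σ(T) q`. -/
def corner (p : B H) (Sig : B H →L[ℂ] B H) (q : B H) : B H →ₗ[ℂ] B H :=
  LinearMap.mulLeft ℂ p ∘ₗ LinearMap.mulRight ℂ q ∘ₗ Sig.toLinearMap

theorem corner_apply (p q T : B H) : corner p Sig q T = p * Sig T * q := by
  simp [corner, mul_assoc]

theorem isContractiveIdem_corner (hD : IsMasa D) (hS : IsSchurIdempotent D Sig) (hc : ‖Sig‖ ≤ 1)
    {p q : B H} (hp : IsStarProjection p) (hpD : p ∈ D) (hq : IsStarProjection q) (hqD : q ∈ D) :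
    IsContractiveIdem D (corner p Sig q) where
  norm_le T := by
    rw [corner_apply]
    calc ‖p * Sig T * q‖ ≤ ‖p‖ * ‖Sig T‖ * ‖q‖ :=
          (norm_mul_le _ _).trans (by gcongr; exact norm_mul_le _ _)
      _ ≤ 1 * (1 * ‖T‖) * 1 := by
          gcongr
          · exact hp.norm_le
          · exact Sig.le_of_opNorm_le hc T
          · exact hq.norm_le
      _ = ‖T‖ := by ring
  bimod a ha b hb T := by
    simp only [corner_apply]
    rw [hS.1.2 a ha b hb, show p * (a * Sig T * b) * q = p * a * Sig T * (b * q) by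
      simp only [mul_assoc], hD.1 p hpD a ha, hD.1 b hb q hqD]
    simp only [mul_assoc]
  idem T := by
    simp only [corner_apply]
    rw [hS.1.2 p hpD q hqD, hS.apply_apply, show p * (p * Sig T * q) * q = p * p * Sig T * (q * q) by
      simp only [mul_assoc], hp.isIdempotentElem.eq, hq.isIdempotentElem.eq]

theorem exists_fixed_rankOne_of_corner_ne_zero (hD : IsMasa D) (hS : IsSchurIdempotent D Sig)
    (hc : ‖Sig‖ ≤ 1) {p q : B H} (hp : IsStarProjection p) (hpD : p ∈ D)
    (hq : IsStarProjection q) (hqD : q ∈ D) {T : B H} (hT : p * Sig T * q ≠ 0) :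
    ∃ w v : H, ‖w‖ = 1 ∧ ‖v‖ = 1 ∧ p w = w ∧ q v = v ∧ Sig (rankOne ℂ w v) = rankOne ℂ w v := by
  have hΘ := isContractiveIdem_corner hD hS hc hp hpD hq hqD
  obtain ⟨x, y, hxy⟩ : ∃ x y, corner p Sig q (rankOne ℂ x y) ≠ 0 := by
    by_contra! h0
    refine hT ?_
    simpa using hS.1.1.mul_mul_eq (C := p) (E := q) (C' := 0) (E' := 0)
      (fun x y => by rw [← corner_apply, h0]; simp) T
  obtain ⟨w, v, hw, hv, hwv⟩ := hΘ.exists_fixed_rankOne hD hxy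
  rw [corner_apply] at hwv
  have hpp := hp.isIdempotentElem.eq
  have hqq := hq.isIdempotentElem.eq
  have hpw : p w = w := by
    have h1 : p * rankOne ℂ w v = rankOne ℂ w v := by
      rw [← hwv]; simp only [← mul_assoc, hpp]
    simpa [hv] using DFunLike.congr_fun h1 v
  have hqv : q v = v := by
    have h1 : rankOne ℂ w v * q = rankOne ℂ w v := by
      rw [← hwv]; simp only [mul_assoc, hqq]
    rw [rankOne_mul, hq.isSelfAdjoint.star_eq] at h1
    have h2 : rankOne ℂ w (q v - v) = 0 := by rw [map_sub, h1, sub_self]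
    have h3 : ‖w‖ * ‖q v - v‖ = 0 := by rw [← InnerProductSpace.norm_rankOne (𝕜 := ℂ), h2, norm_zero]
    rw [hw, one_mul, norm_eq_zero, sub_eq_zero] at h3
    exact h3
  refine ⟨w, v, hw, hv, hpw, hqv, ?_⟩
  have h1 : Sig (p * Sig (rankOne ℂ w v) * q) = p * Sig (rankOne ℂ w v) * q := by
    rw [hS.1.2 p hpD q hqD, hS.apply_apply]
  rwa [hwv] at h1

/-- The space of vectors `w` such that `w ⊗ v*` is fixed by `Σ`. -/
def leftSpace (Sig : B H →L[ℂ] B H) (v : H) : Submodule ℂ H :=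
  LinearMap.ker ((Sig - ContinuousLinearMap.id ℂ (B H)).comp ((rankOne ℂ).flip v)).toLinearMap

/-- The space of vectors `v` such that `w ⊗ v*` is fixed by `Σ`. -/
def rightSpace (Sig : B H →L[ℂ] B H) (w : H) : Submodule ℂ H :=
  LinearMap.ker ((Sig - ContinuousLinearMap.id ℂ (B H)).comp (rankOne ℂ w)).toLinearMap

theorem mem_leftSpace {w v : H} :
    w ∈ leftSpace Sig v ↔ Sig (rankOne ℂ w v) = rankOne ℂ w v := by
  simp [leftSpace, sub_eq_zero]

theorem mem_rightSpace {w v : H} :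
    v ∈ rightSpace Sig w ↔ Sig (rankOne ℂ w v) = rankOne ℂ w v := by
  simp [rightSpace, sub_eq_zero]

theorem mem_leftSpace_iff_mem_rightSpace {w v : H} :
    w ∈ leftSpace Sig v ↔ v ∈ rightSpace Sig w := by
  rw [mem_leftSpace, mem_rightSpace]

instance (v : H) : (leftSpace Sig v).HasOrthogonalProjection :=
  have : IsClosed (leftSpace Sig v : Set H) := ContinuousLinearMap.isClosed_ker _
  have := this.completeSpace_coe
  inferInstance

instance (w : H) : (rightSpace Sig w).HasOrthogonalProjection :=
  have : IsClosed (rightSpace Sig w : Set H) := ContinuousLinearMap.isClosed_ker _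
  have := this.completeSpace_coe
  inferInstance

theorem apply_mem_leftSpace (hS : IsSchurIdempotent D Sig) {a : B H} (ha : a ∈ D) {w v : H}
    (h : w ∈ leftSpace Sig v) : a w ∈ leftSpace Sig v := by
  rw [mem_leftSpace] at h ⊢
  rw [← mul_rankOne, hS.map_mul_left ha, h]

theorem apply_mem_rightSpace (hS : IsSchurIdempotent D Sig) {a : B H} (ha : a ∈ D) {w v : H}
    (h : v ∈ rightSpace Sig w) : a v ∈ rightSpace Sig w := by
  rw [mem_rightSpace] at h ⊢
  have h1 := rankOne_mul (star a) w v
  rw [star_star] at h1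
  rw [← h1, hS.map_mul_right (star_mem ha), h]

theorem norm_sq_smul_add_smul {w₁ w₂ : H} (h₁ : ‖w₁‖ = 1) (h₂ : ‖w₂‖ = 1)
    (h : ⟪w₁, w₂⟫_ℂ = 0) (a b : ℂ) : ‖a • w₁ + b • w₂‖ ^ 2 = ‖a‖ ^ 2 + ‖b‖ ^ 2 := by
  rw [pow_two, norm_add_sq_eq_norm_sq_add_norm_sq_of_inner_eq_zero (𝕜 := ℂ) _ _
    (by rw [inner_smul_left, inner_smul_right, h, mul_zero, mul_zero]), norm_smul, norm_smul, h₁,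
    h₂]
  ring

theorem norm_inner_sq_add_norm_inner_sq_le {v₁ v₂ : H} (h₁ : ‖v₁‖ = 1) (h₂ : ‖v₂‖ = 1)
    (h : ⟪v₁, v₂⟫_ℂ = 0) (z : H) : ‖⟪v₁, z⟫_ℂ‖ ^ 2 + ‖⟪v₂, z⟫_ℂ‖ ^ 2 ≤ ‖z‖ ^ 2 := by
  have ho : Orthonormal ℂ ![v₁, v₂] := by
    rw [orthonormal_vecCons_iff]
    exact ⟨h₁, by simp [h], by simp [h₂, Orthonormal, Pairwise]⟩
  simpa using ho.sum_inner_products_le z (s := Finset.univ)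

theorem norm_rankOne_add_smul_rankOne_le {w₁ w₂ v₁ v₂ : H} (hw₁ : ‖w₁‖ = 1) (hw₂ : ‖w₂‖ = 1)
    (hw : ⟪w₁, w₂⟫_ℂ = 0) (hv₁ : ‖v₁‖ = 1) (hv₂ : ‖v₂‖ = 1) (hv : ⟪v₁, v₂⟫_ℂ = 0) {c : ℂ}
    (hc : ‖c‖ = 1) : ‖rankOne ℂ w₁ v₁ + c • rankOne ℂ w₂ v₂‖ ≤ 1 := by
  refine ContinuousLinearMap.opNorm_le_bound _ zero_le_one fun z => ?_
  rw [one_mul, ← sq_le_sq₀ (norm_nonneg _) (norm_nonneg _)]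
  refine le_trans (le_of_eq ?_) (norm_inner_sq_add_norm_inner_sq_le hv₁ hv₂ hv z)
  rw [add_apply, smul_apply, InnerProductSpace.rankOne_apply, InnerProductSpace.rankOne_apply,
    smul_smul, norm_sq_smul_add_smul hw₁ hw₂ hw, norm_mul, hc, one_mul]

/-- The operator with matrix `(1, 1; 1, -1)` has norm at most `√2`. -/
theorem norm_rankOne_comb_sq_le {w₁ w₂ v₁ v₂ : H} (hw₁ : ‖w₁‖ = 1) (hw₂ : ‖w₂‖ = 1)
    (hw : ⟪w₁, w₂⟫_ℂ = 0) (hv₁ : ‖v₁‖ = 1) (hv₂ : ‖v₂‖ = 1) (hv : ⟪v₁, v₂⟫_ℂ = 0) :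
    ‖rankOne ℂ w₁ v₁ + rankOne ℂ w₁ v₂ + rankOne ℂ w₂ v₁ - rankOne ℂ w₂ v₂‖ ≤ √2 := by
  refine ContinuousLinearMap.opNorm_le_bound _ (Real.sqrt_nonneg _) fun z => ?_
  rw [← sq_le_sq₀ (norm_nonneg _) (by positivity), mul_pow, Real.sq_sqrt zero_le_two]
  have h1 : (rankOne ℂ w₁ v₁ + rankOne ℂ w₁ v₂ + rankOne ℂ w₂ v₁ - rankOne ℂ w₂ v₂) z =
      (⟪v₁, z⟫_ℂ + ⟪v₂, z⟫_ℂ) • w₁ + (⟪v₁, z⟫_ℂ - ⟪v₂, z⟫_ℂ) • w₂ := by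
    simp only [add_apply, sub_apply, InnerProductSpace.rankOne_apply]
    module
  rw [h1, norm_sq_smul_add_smul hw₁ hw₂ hw]
  have h2 := parallelogram_law_with_norm ℂ ⟪v₁, z⟫_ℂ ⟪v₂, z⟫_ℂ
  nlinarith [norm_inner_sq_add_norm_inner_sq_le hv₁ hv₂ hv z]

theorem eq_zero_of_norm_add_le_of_norm_sub_le {w z : H} (hw : ‖w‖ = 1) (h1 : ‖w + z‖ ≤ 1)
    (h2 : ‖w - z‖ ≤ 1) : z = 0 := by
  have h3 := parallelogram_law_with_norm ℂ w z
  rw [hw] at h3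
  have h4 : ‖z‖ = 0 := by nlinarith [norm_nonneg z, norm_nonneg (w + z), norm_nonneg (w - z)]
  exact norm_eq_zero.1 h4

theorem fixed_of_orthonormal (hD : IsMasa D) (hS : IsSchurIdempotent D Sig) (hc : ‖Sig‖ ≤ 1)
    {w₁ w₂ v₁ v₂ : H} (hw₁ : ‖w₁‖ = 1) (hw₂ : ‖w₂‖ = 1) (hw : ⟪w₁, w₂⟫_ℂ = 0) (hv₁ : ‖v₁‖ = 1)
    (hv₂ : ‖v₂‖ = 1) (hv : ⟪v₁, v₂⟫_ℂ = 0) (h₁₁ : Sig (rankOne ℂ w₁ v₁) = rankOne ℂ w₁ v₁)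
    (h₁₂ : Sig (rankOne ℂ w₁ v₂) = rankOne ℂ w₁ v₂)
    (h₂₁ : Sig (rankOne ℂ w₂ v₁) = rankOne ℂ w₂ v₁) :
    Sig (rankOne ℂ w₂ v₂) = rankOne ℂ w₂ v₂ := by
  have hle : ∀ T, ‖Sig T‖ ≤ ‖T‖ := fun T => by simpa using Sig.le_of_opNorm_le hc T
  have hΘ : IsContractiveIdem D Sig.toLinearMap :=
    ⟨hle, fun a ha b hb T => hS.1.2 a ha b hb T, hS.apply_apply⟩
  have hww : ⟪w₁, w₁⟫_ℂ = 1 := by simp [inner_self_eq_norm_sq_to_K, hw₁]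
  have hvv : ⟪v₁, v₁⟫_ℂ = 1 := by simp [inner_self_eq_norm_sq_to_K, hv₁]
  have hvv₂ : ⟪v₂, v₂⟫_ℂ = 1 := by simp [inner_self_eq_norm_sq_to_K, hv₂]
  have hv' : ⟪v₂, v₁⟫_ℂ = 0 := inner_eq_zero_symm.1 hv
  refine hΘ.map_rankOne_eq_of_apply_eq hD hw₂ hv₂ ?_
  change Sig (rankOne ℂ w₂ v₂) v₂ = w₂
  set N := Sig (rankOne ℂ w₂ v₂) with hN
  have hA : ∀ c : ℂ, ‖c‖ = 1 → ‖rankOne ℂ w₁ v₁ + c • N‖ ≤ 1 := fun c hc1 => by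
    have := (hle (rankOne ℂ w₁ v₁ + c • rankOne ℂ w₂ v₂)).trans
      (norm_rankOne_add_smul_rankOne_le hw₁ hw₂ hw hv₁ hv₂ hv hc1)
    rwa [map_add, map_smul, h₁₁] at this
  have hNv₁ : N v₁ = 0 := by
    have h1 : ∀ c : ℂ, ‖c‖ = 1 → ‖w₁ + c • N v₁‖ ≤ 1 := fun c hc1 => by
      simpa [hv₁, hvv] using (rankOne ℂ w₁ v₁ + c • N).le_of_opNorm_le (hA c hc1) v₁
    refine eq_zero_of_norm_add_le_of_norm_sub_le hw₁ (by simpa using h1 1 (by simp)) ?_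
    simpa [sub_eq_add_neg] using h1 (-1) (by simp)
  have hNw₁ : star N w₁ = 0 := by
    have h1 : ∀ c : ℂ, ‖c‖ = 1 → ‖v₁ + star c • star N w₁‖ ≤ 1 := fun c hc1 => by
      have h2 := (star (rankOne ℂ w₁ v₁ + c • N)).le_of_opNorm_le
        ((norm_star _).trans_le (hA c hc1)) w₁
      have h3 : star (rankOne ℂ w₁ v₁) w₁ = v₁ := by
        rw [ContinuousLinearMap.star_eq_adjoint, InnerProductSpace.adjoint_rankOne]
        simp [hw₁]
      rw [star_add, star_smul, add_apply, smul_apply, h3, hw₁] at h2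
      simpa using h2
    refine eq_zero_of_norm_add_le_of_norm_sub_le hv₁ (by simpa using h1 1 (by simp)) ?_
    simpa [sub_eq_add_neg] using h1 (-1) (by simp)
  have horth : ⟪w₁, w₂ - N v₂⟫_ℂ = 0 := by
    rw [inner_sub_right, hw, ← ContinuousLinearMap.adjoint_inner_left,
      ← ContinuousLinearMap.star_eq_adjoint, hNw₁, inner_zero_left, sub_zero]
  have hT : ‖rankOne ℂ w₁ v₁ + rankOne ℂ w₁ v₂ + rankOne ℂ w₂ v₁ - N‖ ≤ √2 := by
    have := (hle _).trans (norm_rankOne_comb_sq_le hw₁ hw₂ hw hv₁ hv₂ hv)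
    rwa [map_sub, map_add, map_add, h₁₁, h₁₂, h₂₁] at this
  have hap := ContinuousLinearMap.le_of_opNorm_le _ hT (v₁ + v₂)
  have h2 : (rankOne ℂ w₁ v₁ + rankOne ℂ w₁ v₂ + rankOne ℂ w₂ v₁ - N) (v₁ + v₂) =
      (2 : ℂ) • w₁ + (w₂ - N v₂) := by
    simp only [sub_apply, add_apply, InnerProductSpace.rankOne_apply, map_add, hNv₁,
      hvv, hv, hv', hvv₂]
    module
  have h3 : ‖v₁ + v₂‖ ^ 2 = 2 := by
    have := norm_sq_smul_add_smul hv₁ hv₂ hv 1 1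
    rw [one_smul, one_smul] at this
    rw [this]; norm_num
  have h4 : ‖(2 : ℂ) • w₁ + (w₂ - N v₂)‖ ^ 2 = 4 + ‖w₂ - N v₂‖ ^ 2 := by
    rw [pow_two, norm_add_sq_eq_norm_sq_add_norm_sq_of_inner_eq_zero (𝕜 := ℂ) _ _
      (by rw [inner_smul_left, horth, mul_zero]), norm_smul, hw₁]
    norm_num
    ring
  rw [h2, ← sq_le_sq₀ (norm_nonneg _) (by positivity), mul_pow, h3, h4,
    Real.sq_sqrt zero_le_two] at hap
  have h5 : ‖w₂ - N v₂‖ = 0 := by nlinarith [norm_nonneg (w₂ - N v₂)]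
  exact (sub_eq_zero.1 (norm_eq_zero.1 h5)).symm

end SchurHyper

namespace SchurHyper

variable {H : Type*} [NormedAddCommGroup H] [InnerProductSpace ℂ H] [CompleteSpace H]
variable {D : StarSubalgebra ℂ (B H)} {Sig : B H →L[ℂ] B H}

theorem mem_rightSpace_of_orthogonal (hD : IsMasa D) (hS : IsSchurIdempotent D Sig)
    (hc : ‖Sig‖ ≤ 1) {w₁ w₂ v₁ v₂ : H} (hw₁ : w₁ ≠ 0) (hv₁ : v₁ ≠ 0) (hw : ⟪w₁, w₂⟫_ℂ = 0)
    (hv : ⟪v₁, v₂⟫_ℂ = 0) (h₁₁ : v₁ ∈ rightSpace Sig w₁) (h₁₂ : v₂ ∈ rightSpace Sig w₁)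
    (h₂₁ : v₁ ∈ rightSpace Sig w₂) : v₂ ∈ rightSpace Sig w₂ := by
  rcases eq_or_ne w₂ 0 with rfl | hw₂
  · simp [mem_rightSpace]
  rcases eq_or_ne v₂ 0 with rfl | hv₂
  · exact zero_mem _
  have hsmul : ∀ {w v : H} (a b : ℂ), v ∈ rightSpace Sig w → b • v ∈ rightSpace Sig (a • w) :=
    fun a b h => mem_leftSpace_iff_mem_rightSpace.1 <|
      Submodule.smul_mem _ a <| mem_leftSpace_iff_mem_rightSpace.2 <| Submodule.smul_mem _ b h
  have horth : ∀ {x y : H} (a b : ℂ), ⟪x, y⟫_ℂ = 0 → ⟪a • x, b • y⟫_ℂ = 0 := fun a b h => by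
    rw [inner_smul_left, inner_smul_right, h, mul_zero, mul_zero]
  have h := mem_rightSpace.2 <| fixed_of_orthonormal hD hS hc (norm_smul_inv_norm (𝕜 := ℂ) hw₁)
    (norm_smul_inv_norm (𝕜 := ℂ) hw₂) (horth _ _ hw) (norm_smul_inv_norm (𝕜 := ℂ) hv₁)
    (norm_smul_inv_norm (𝕜 := ℂ) hv₂) (horth _ _ hv) (mem_rightSpace.1 (hsmul _ _ h₁₁))
    (mem_rightSpace.1 (hsmul _ _ h₁₂)) (mem_rightSpace.1 (hsmul _ _ h₂₁))
  have hn : ∀ {x : H}, x ≠ 0 → (RCLike.ofReal ‖x‖ : ℂ) • (RCLike.ofReal ‖x‖ : ℂ)⁻¹ • x = x := fun hx =>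
    smul_inv_smul₀ (by simpa using hx) _
  have h' := hsmul (RCLike.ofReal ‖w₂‖) (RCLike.ofReal ‖v₂‖) h
  rwa [hn hw₂, hn hv₂] at h'

/-- Three corners of a rectangle of fixed rank one operators determine the fourth. -/
theorem mem_rightSpace_of_rectangle (hD : IsMasa D) (hS : IsSchurIdempotent D Sig)
    (hc : ‖Sig‖ ≤ 1) {w₁ w₂ v₁ v₂ : H} (hw₁ : w₁ ≠ 0) (hv₁ : v₁ ≠ 0)
    (h₁₁ : v₁ ∈ rightSpace Sig w₁) (h₁₂ : v₂ ∈ rightSpace Sig w₁)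
    (h₂₁ : v₁ ∈ rightSpace Sig w₂) : v₂ ∈ rightSpace Sig w₂ := by
  have horth : ∀ {x : H} (y : H), x ≠ 0 → ⟪x, y - (⟪x, y⟫_ℂ / ⟪x, x⟫_ℂ) • x⟫_ℂ = 0 :=
    fun y hx => by
      rw [inner_sub_right, inner_smul_right, div_mul_cancel₀ _ (inner_self_ne_zero.2 hx), sub_self]
  set c := ⟪w₁, w₂⟫_ℂ / ⟪w₁, w₁⟫_ℂ
  set d := ⟪v₁, v₂⟫_ℂ / ⟪v₁, v₁⟫_ℂ
  have h₂₁' : v₁ ∈ rightSpace Sig (w₂ - c • w₁) := mem_leftSpace_iff_mem_rightSpace.1 <|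
    sub_mem (mem_leftSpace_iff_mem_rightSpace.2 h₂₁)
      (Submodule.smul_mem _ _ (mem_leftSpace_iff_mem_rightSpace.2 h₁₁))
  have h₁₂' : v₂ - d • v₁ ∈ rightSpace Sig w₁ := sub_mem h₁₂ (Submodule.smul_mem _ _ h₁₁)
  have h := mem_rightSpace_of_orthogonal hD hS hc hw₁ hv₁ (horth w₂ hw₁) (horth v₂ hv₁) h₁₁ h₁₂'
    h₂₁'
  have h' : v₂ ∈ rightSpace Sig (w₂ - c • w₁) := by
    rw [← sub_add_cancel v₂ (d • v₁)]
    exact add_mem h (Submodule.smul_mem _ d h₂₁')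
  rw [← mem_leftSpace_iff_mem_rightSpace] at h' h₁₂ ⊢
  rw [← sub_add_cancel w₂ (c • w₁)]
  exact add_mem h' (Submodule.smul_mem _ c h₁₂)

/-- A pair of projections `(e, f)` of `D` forms a block of `Σ` if the rows in `e` and the columns
in `f` of `Σ(T)` are those of `e T f`. -/
structure IsBlock (D : StarSubalgebra ℂ (B H)) (Sig : B H →L[ℂ] B H) (e f : B H) : Prop where
  left : IsStarProjection e
  right : IsStarProjection f
  left_mem : e ∈ D
  right_mem : f ∈ D
  left_ne_zero : e ≠ 0
  right_ne_zero : f ≠ 0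
  mul_apply : ∀ T, e * Sig T = e * T * f
  apply_mul : ∀ T, Sig T * f = e * T * f

theorem eq_zero_or_eq_zero_of_forall_mul_mul {a b : B H} (h : ∀ T, a * T * b = 0) :
    a = 0 ∨ b = 0 := by
  by_contra! hab
  obtain ⟨x, hx⟩ : ∃ x, a x ≠ 0 := by
    by_contra! h0; exact hab.1 (ContinuousLinearMap.ext h0)
  obtain ⟨y, hy⟩ : ∃ y, b y ≠ 0 := by
    by_contra! h0; exact hab.2 (ContinuousLinearMap.ext h0)
  have h1 := DFunLike.congr_fun (h (rankOne ℂ x (b y))) y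
  rw [mul_rankOne] at h1
  simp [hx, hy] at h1

theorem eq_of_forall_mul_mul_eq_right {a b b' : B H} (ha : a ≠ 0)
    (h : ∀ T, a * T * b = a * T * b') : b = b' :=
  sub_eq_zero.1 <| (eq_zero_or_eq_zero_of_forall_mul_mul (a := a) (b := b - b')
    fun T => by rw [mul_sub, h, sub_self]).resolve_left ha

theorem eq_of_forall_mul_mul_eq_left {a a' b : B H} (hb : b ≠ 0)
    (h : ∀ T, a * T * b = a' * T * b) : a = a' :=
  sub_eq_zero.1 <| (eq_zero_or_eq_zero_of_forall_mul_mul (a := a - a') (b := b)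
    fun T => by rw [sub_mul, sub_mul, h, sub_self]).resolve_right hb

namespace IsBlock

variable {e f e' f' : B H}

theorem eq_right_of_mul_ne_zero (hD : IsMasa D) (h : IsBlock D Sig e f) (h' : IsBlock D Sig e' f')
    (he : e * e' ≠ 0) : f = f' := by
  refine eq_of_forall_mul_mul_eq_right he fun T => ?_
  calc e * e' * T * f = e' * (e * T * f) := by
        rw [hD.1 e h.left_mem e' h'.left_mem]; simp only [mul_assoc]
    _ = e * (e' * Sig T) := by
        rw [← h.mul_apply, ← mul_assoc, ← hD.1 e h.left_mem e' h'.left_mem, mul_assoc]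
    _ = e * e' * T * f' := by rw [h'.mul_apply]; simp only [mul_assoc]

theorem eq_left_of_mul_ne_zero (hD : IsMasa D) (h : IsBlock D Sig e f) (h' : IsBlock D Sig e' f')
    (hf : f * f' ≠ 0) : e = e' := by
  refine eq_of_forall_mul_mul_eq_left hf fun T => ?_
  rw [← mul_assoc, ← h.apply_mul, mul_assoc, hD.1 f h.right_mem f' h'.right_mem, ← mul_assoc,
    h'.apply_mul, mul_assoc]

theorem left_mul_left_eq_zero (hD : IsMasa D) (h : IsBlock D Sig e f) (h' : IsBlock D Sig e' f')
    (hne : (e, f) ≠ (e', f')) : e * e' = 0 := by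
  by_contra he
  obtain rfl := h.eq_right_of_mul_ne_zero hD h' he
  obtain rfl := h.eq_left_of_mul_ne_zero hD h' <| by
    rw [h.right.isIdempotentElem.eq]; exact h.right_ne_zero
  exact hne rfl

theorem right_mul_right_eq_zero (hD : IsMasa D) (h : IsBlock D Sig e f)
    (h' : IsBlock D Sig e' f') (hne : (e, f) ≠ (e', f')) : f * f' = 0 := by
  by_contra hf
  obtain rfl := h.eq_left_of_mul_ne_zero hD h' hf
  obtain rfl := h.eq_right_of_mul_ne_zero hD h' <| by
    rw [h.left.isIdempotentElem.eq]; exact h.left_ne_zero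
  exact hne rfl

end IsBlock

theorem exists_isBlock (hD : IsMasa D) (hS : IsSchurIdempotent D Sig) (hc : ‖Sig‖ ≤ 1) {w v : H}
    (hw : w ≠ 0) (hv : v ≠ 0) (hwv : v ∈ rightSpace Sig w) :
    ∃ e f, IsBlock D Sig e f ∧ f v = v := by
  have hwv' := mem_leftSpace_iff_mem_rightSpace.2 hwv
  set e := (leftSpace Sig v).starProjection with he
  set f := (rightSpace Sig w).starProjection with hf
  have heD : e ∈ D := hD.starProjection_mem _ fun a ha z hz => apply_mem_leftSpace hS ha hz
  have hfD : f ∈ D := hD.starProjection_mem _ fun a ha z hz => apply_mem_rightSpace hS ha hz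
  have heP : IsStarProjection e := isStarProjection_starProjection
  have hfP : IsStarProjection f := isStarProjection_starProjection
  have hew : e w = w := Submodule.starProjection_eq_self_iff.2 hwv'
  have hfv : f v = v := Submodule.starProjection_eq_self_iff.2 hwv
  have hef : ∀ T, e * Sig T * f = e * T * f := fun T => by
    refine hS.1.1.mul_mul_eq (fun x y => ?_) T
    rw [← hS.1.2 e heD f hfD, mul_rankOne, rankOne_mul, hfP.isSelfAdjoint.star_eq]
    refine mem_rightSpace.1 (mem_rightSpace_of_rectangle hD hS hc hw hv hwv ?_ ?_)
    · exact Submodule.starProjection_apply_mem _ _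
    · exact mem_leftSpace_iff_mem_rightSpace.1 (Submodule.starProjection_apply_mem _ _)
  have hne : ∀ {p : B H} {z : H}, p z = z → (1 - p) z = z → z = 0 := fun {p z} h1 h2 => by
    rw [← h2, sub_apply, h1]; simp
  have hzero : ∀ {z : H}, ‖z‖ = 1 → z ≠ 0 := fun h => by
    rw [← norm_ne_zero_iff, h]; exact one_ne_zero
  have hr : ∀ T, e * Sig T * (1 - f) = 0 := fun T => by
    by_contra h0
    obtain ⟨w', v', hw', hv', hew', hfv', hfix⟩ := exists_fixed_rankOne_of_corner_ne_zero hD hS hc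
      heP heD hfP.one_sub (sub_mem (one_mem D) hfD) h0
    have h1 : v ∈ rightSpace Sig w' :=
      mem_leftSpace_iff_mem_rightSpace.1 (Submodule.starProjection_eq_self_iff.1 hew')
    have h2 := mem_rightSpace_of_rectangle hD hS hc (hzero hw') hv h1 (mem_rightSpace.2 hfix) hwv
    exact hzero hv' (hne (Submodule.starProjection_eq_self_iff.2 h2) hfv')
  have hl : ∀ T, (1 - e) * Sig T * f = 0 := fun T => by
    by_contra h0
    obtain ⟨w', v', hw', hv', hew', hfv', hfix⟩ := exists_fixed_rankOne_of_corner_ne_zero hD hS hc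
      heP.one_sub (sub_mem (one_mem D) heD) hfP hfD h0
    have h1 : v' ∈ rightSpace Sig w := Submodule.starProjection_eq_self_iff.1 hfv'
    have h2 := mem_leftSpace_iff_mem_rightSpace.2 <|
      mem_rightSpace_of_rectangle hD hS hc hw (hzero hv') h1 hwv (mem_rightSpace.2 hfix)
    exact hzero hw' (hne (Submodule.starProjection_eq_self_iff.2 h2) hew')
  refine ⟨e, f, ⟨heP, hfP, heD, hfD, ?_, ?_, fun T => ?_, fun T => ?_⟩, hfv⟩
  · rintro h; rw [h] at hew; exact hw hew.symm
  · rintro h; rw [h] at hfv; exact hv hfv.symm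
  · rw [← hef, ← sub_eq_zero, ← hr T]; noncomm_ring
  · rw [← hef, ← sub_eq_zero, ← hl T]; noncomm_ring

end SchurHyper

namespace SchurHyper

variable {H : Type*} [NormedAddCommGroup H] [InnerProductSpace ℂ H] [CompleteSpace H]
variable {D : StarSubalgebra ℂ (B H)} {Sig : B H →L[ℂ] B H}

/-- A finite set of blocks of `Σ`. -/
def IsBlockSet (D : StarSubalgebra ℂ (B H)) (Sig : B H →L[ℂ] B H) (K : Finset (B H × B H)) :
    Prop :=
  ∀ k ∈ K, IsBlock D Sig k.1 k.2

namespace IsBlockSet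

variable {K K' : Finset (B H × B H)}

theorem union [DecidableEq (B H × B H)] (h : IsBlockSet D Sig K) (h' : IsBlockSet D Sig K') :
    IsBlockSet D Sig (K ∪ K') := fun k hk =>
  (Finset.mem_union.1 hk).elim (h k) (h' k)

theorem mul_sum_right_of_mem (hD : IsMasa D) (h : IsBlockSet D Sig K) {j : B H × B H}
    (hj : j ∈ K) : j.2 * ∑ k ∈ K, k.2 = j.2 := by
  rw [Finset.mul_sum, Finset.sum_eq_single_of_mem j hj fun k hk hkj =>
    (h j hj).right_mul_right_eq_zero hD (h k hk) hkj.symm]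
  exact (h j hj).right.isIdempotentElem.eq

theorem mul_sum_right_of_notMem (hD : IsMasa D) (h : IsBlockSet D Sig K) {j : B H × B H}
    (hj : j ∉ K) (hjb : IsBlock D Sig j.1 j.2) : j.2 * ∑ k ∈ K, k.2 = 0 := by
  rw [Finset.mul_sum]
  exact Finset.sum_eq_zero fun k hk =>
    hjb.right_mul_right_eq_zero hD (h k hk) fun hjk => hj (by rwa [show j = k from hjk])

theorem isStarProjection_sum_right (hD : IsMasa D) (h : IsBlockSet D Sig K) :
    IsStarProjection (∑ k ∈ K, k.2) where
  isIdempotentElem := by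
    rw [IsIdempotentElem, Finset.sum_mul]
    exact Finset.sum_congr rfl fun j hj => h.mul_sum_right_of_mem hD hj
  isSelfAdjoint := by
    rw [isSelfAdjoint_iff, star_sum]
    exact Finset.sum_congr rfl fun j hj => (h j hj).right.isSelfAdjoint.star_eq

theorem sum_right_apply_of_subset (hD : IsMasa D) (h : IsBlockSet D Sig K)
    (h' : IsBlockSet D Sig K') (hK : K ⊆ K') {z : H} (hz : (∑ k ∈ K, k.2) z = z) :
    (∑ k ∈ K', k.2) z = z := by
  rw [← hz, ← mul_apply_eq_comp, Finset.sum_mul, ← Finset.sum_subset hK fun j hj hjK =>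
    h.mul_sum_right_of_notMem hD hjK (h' j hj)]
  rw [Finset.sum_congr rfl fun j hj => h.mul_sum_right_of_mem hD hj]

end IsBlockSet

/-- The span of the ranges of the right projections of the blocks of `Σ`. -/
def blockSpace (hD : IsMasa D) (Sig : B H →L[ℂ] B H) : Submodule ℂ H where
  carrier := {z | ∃ K, IsBlockSet D Sig K ∧ (∑ k ∈ K, k.2) z = z}
  zero_mem' := ⟨∅, by simp [IsBlockSet], by simp⟩
  add_mem' := by
    classical
    rintro x y ⟨K, hK, hx⟩ ⟨L, hL, hy⟩
    refine ⟨K ∪ L, hK.union hL, ?_⟩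
    rw [map_add, hK.sum_right_apply_of_subset hD (hK.union hL) Finset.subset_union_left hx,
      hL.sum_right_apply_of_subset hD (hK.union hL) Finset.subset_union_right hy]
  smul_mem' := by
    rintro c x ⟨K, hK, hx⟩
    exact ⟨K, hK, by rw [map_smul, hx]⟩

theorem mem_blockSpace {hD : IsMasa D} {z : H} :
    z ∈ blockSpace hD Sig ↔ ∃ K, IsBlockSet D Sig K ∧ (∑ k ∈ K, k.2) z = z := Iff.rfl

theorem IsBlock.apply_mem_blockSpace {hD : IsMasa D} {e f : B H} (h : IsBlock D Sig e f) (z : H) :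
    f z ∈ blockSpace hD Sig := by
  refine mem_blockSpace.2 ⟨{(e, f)}, by simpa [IsBlockSet] using h, ?_⟩
  rw [Finset.sum_singleton, ← mul_apply_eq_comp, h.right.isIdempotentElem.eq]

theorem apply_mem_blockSpace {hD : IsMasa D} {a : B H} (ha : a ∈ D) {z : H}
    (hz : z ∈ blockSpace hD Sig) : a z ∈ blockSpace hD Sig := by
  obtain ⟨K, hK, hz⟩ := mem_blockSpace.1 hz
  refine mem_blockSpace.2 ⟨K, hK, ?_⟩
  rw [← mul_apply_eq_comp, ← hD.1 a ha _ (sum_mem fun k hk => (hK k hk).right_mem),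
    mul_apply_eq_comp, hz]

/-- The projection onto the closed span of the ranges of the right projections of the blocks. -/
def blockProj (hD : IsMasa D) (Sig : B H →L[ℂ] B H) : B H :=
  (blockSpace hD Sig).topologicalClosure.starProjection

theorem blockProj_mem (hD : IsMasa D) (Sig : B H →L[ℂ] B H) : blockProj hD Sig ∈ D :=
  hD.starProjection_mem _ fun _ ha => apply_mem_closure_of_forall fun _ hz =>
    subset_closure (apply_mem_blockSpace ha hz)

theorem isStarProjection_blockProj (hD : IsMasa D) (Sig : B H →L[ℂ] B H) :
    IsStarProjection (blockProj hD Sig) := isStarProjection_starProjection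

theorem blockProj_apply_eq_self {hD : IsMasa D} {z : H} (hz : z ∈ blockSpace hD Sig) :
    blockProj hD Sig z = z :=
  Submodule.starProjection_eq_self_iff.2 (subset_closure hz)

theorem IsBlock.mul_blockProj (hD : IsMasa D) {e f : B H} (h : IsBlock D Sig e f) :
    f * blockProj hD Sig = f := by
  rw [hD.1 f h.right_mem _ (blockProj_mem hD Sig)]
  ext z
  exact blockProj_apply_eq_self (h.apply_mem_blockSpace z)

theorem apply_mul_blockProj (hD : IsMasa D) (hS : IsSchurIdempotent D Sig) (hc : ‖Sig‖ ≤ 1)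
    (T : B H) : Sig T * blockProj hD Sig = Sig T := by
  by_contra h0
  have h1 : 1 * Sig T * (1 - blockProj hD Sig) ≠ 0 := by
    rwa [one_mul, mul_sub, mul_one, sub_ne_zero, ne_comm]
  obtain ⟨w, v, hw, hv, -, hPv, hfix⟩ := exists_fixed_rankOne_of_corner_ne_zero hD hS hc
    (.one _) (one_mem D) (isStarProjection_blockProj hD Sig).one_sub
    (sub_mem (one_mem D) (blockProj_mem hD Sig)) h1
  obtain ⟨e, f, hef, hfv⟩ := exists_isBlock hD hS hc (norm_ne_zero_iff.1 (by rw [hw]; simp))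
    (norm_ne_zero_iff.1 (by rw [hv]; simp)) (mem_rightSpace.2 hfix)
  have h2 : blockProj hD Sig v = v := by
    rw [← hfv]; exact blockProj_apply_eq_self (hef.apply_mem_blockSpace v)
  rw [sub_apply, h2, one_apply_eq_self, sub_self] at hPv
  simp [← hPv] at hv

theorem exists_norm_blockProj_sub_le (hD : IsMasa D) (Sig : B H →L[ℂ] B H) (ξ : H) {ε : ℝ}
    (hε : 0 < ε) :
    ∃ K, IsBlockSet D Sig K ∧ ‖blockProj hD Sig ξ - (∑ k ∈ K, k.2) ξ‖ ≤ ε := by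
  have h1 : blockProj hD Sig ξ ∈ closure (blockSpace hD Sig : Set H) :=
    Submodule.starProjection_apply_mem (blockSpace hD Sig).topologicalClosure ξ
  obtain ⟨z, hz, hξz⟩ := Metric.mem_closure_iff.1 h1 ε hε
  obtain ⟨K, hK, hKz⟩ := mem_blockSpace.1 hz
  refine ⟨K, hK, ?_⟩
  have h2 : (∑ k ∈ K, k.2) * blockProj hD Sig = ∑ k ∈ K, k.2 := by
    rw [Finset.sum_mul]
    exact Finset.sum_congr rfl fun k hk => (hK k hk).mul_blockProj hD
  have h3 : blockProj hD Sig ξ - (∑ k ∈ K, k.2) ξ =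
      (1 - ∑ k ∈ K, k.2) (blockProj hD Sig ξ - z) := by
    rw [sub_apply, one_apply_eq_self, map_sub, hKz, ← mul_apply_eq_comp, h2]
    abel
  rw [h3]
  refine ((1 - ∑ k ∈ K, k.2).le_of_opNorm_le
    (hK.isStarProjection_sum_right hD).one_sub.norm_le _).trans ?_
  rw [one_mul, ← dist_eq_norm]
  exact hξz.le

theorem IsBlock.map_mul_mul {Φ : B H →L[ℂ] B H} (hΦ : IsSchurIdempotent D Φ) {e f : B H}
    (h : IsBlock D Sig e f) (T : B H) : Φ (e * T * f) = e * Φ T * f :=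
  hΦ.1.2 e h.left_mem f h.right_mem T

/-- A contractive Schur idempotent commutes with every Schur idempotent. -/
theorem IsSchurIdempotent.commute_of_norm_le_one (hD : IsMasa D) {Φ : B H →L[ℂ] B H}
    (hΦ : IsSchurIdempotent D Φ) (hS : IsSchurIdempotent D Sig) (hc : ‖Sig‖ ≤ 1) (T : B H) :
    Φ (Sig T) = Sig (Φ T) := by
  have hF := blockProj_mem hD Sig
  rw [← apply_mul_blockProj hD hS hc (Φ T), ← apply_mul_blockProj hD hS hc T,
    hΦ.map_mul_right hF]
  have hblock : ∀ {e f}, IsBlock D Sig e f → Φ (Sig T) * f = Sig (Φ T) * f := fun h => by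
    rw [← hΦ.map_mul_right h.right_mem, h.apply_mul, h.apply_mul, h.map_mul_mul hΦ]
  ext ξ
  refine Submodule.topologicalClosure_minimal (blockSpace hD Sig)
    (t := LinearMap.eqLocus (Φ (Sig T)).toLinearMap (Sig (Φ T)).toLinearMap) (fun z hz => ?_)
    ?_ (Submodule.starProjection_apply_mem _ ξ)
  · obtain ⟨K, hK, hKz⟩ := mem_blockSpace.1 hz
    rw [LinearMap.mem_eqLocus, ← hKz]
    change (Φ (Sig T) * ∑ k ∈ K, k.2) z = (Sig (Φ T) * ∑ k ∈ K, k.2) z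
    rw [Finset.mul_sum, Finset.mul_sum, Finset.sum_congr rfl fun k hk => hblock (hK k hk)]
  · exact isClosed_eq (Φ (Sig T)).continuous (Sig (Φ T)).continuous

theorem IsSchurIdempotent.id_sub_comp (hD : IsMasa D) {Φ : B H →L[ℂ] B H}
    (hΦ : IsSchurIdempotent D Φ) (hS : IsSchurIdempotent D Sig) (hc : ‖Sig‖ ≤ 1) :
    IsSchurIdempotent D (ContinuousLinearMap.id ℂ (B H) -
      (ContinuousLinearMap.id ℂ (B H) - Φ).comp Sig) := by
  refine ⟨⟨wStarContinuous_id.sub ((wStarContinuous_id.sub hΦ.1.1).comp hS.1.1),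
    fun a ha b hb T => ?_⟩, ?_⟩
  · simp only [sub_apply, ContinuousLinearMap.comp_apply, ContinuousLinearMap.id_apply]
    rw [hS.1.2 a ha b hb, hΦ.1.2 a ha b hb]
    noncomm_ring
  · ext1 T
    simp only [sub_apply, ContinuousLinearMap.comp_apply, ContinuousLinearMap.id_apply, map_sub,
      hS.apply_apply, ← hΦ.commute_of_norm_le_one hD hS hc, hΦ.apply_apply]
    abel

end SchurHyper

namespace SchurHyper

variable {H : Type*} [NormedAddCommGroup H] [InnerProductSpace ℂ H] [CompleteSpace H]
variable {D : StarSubalgebra ℂ (B H)} {Sig : B H →L[ℂ] B H}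

theorem arveson_nonneg (T : B H) (X : Set (B H)) : 0 ≤ arveson T X :=
  Real.iSup_nonneg fun _ => Real.iInf_nonneg fun _ => norm_nonneg _

theorem bddBelow_range_norm_sub (T : B H) (X : Set (B H)) (ξ : H) :
    BddBelow (Set.range fun S : X => ‖T ξ - S.1 ξ‖) :=
  ⟨0, by rintro _ ⟨S, rfl⟩; exact norm_nonneg _⟩

theorem arveson_le {T : B H} {X : Set (B H)} {c : ℝ} (hc : 0 ≤ c)
    (h : ∀ ξ, ‖ξ‖ = 1 → ∀ ε > 0, ∃ S ∈ X, ‖T ξ - S ξ‖ ≤ c + ε) : arveson T X ≤ c := by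
  refine Real.iSup_le (fun ξ => le_of_forall_pos_le_add fun ε hε => ?_) hc
  obtain ⟨S, hS, hle⟩ := h ξ.1 ξ.2 ε hε
  exact (ciInf_le (bddBelow_range_norm_sub T X ξ.1) ⟨S, hS⟩).trans hle

theorem exists_norm_sub_le_arveson (T : B H) {X : Set (B H)} (hX : 0 ∈ X) (ξ : H) {ε : ℝ}
    (hε : 0 < ε) : ∃ S ∈ X, ‖T ξ - S ξ‖ ≤ (arveson T X + ε) * ‖ξ‖ := by
  rcases eq_or_ne ξ 0 with rfl | hξ
  · exact ⟨0, hX, by simp⟩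
  have hη := norm_smul_inv_norm (𝕜 := ℂ) hξ
  set η : H := ((‖ξ‖ : ℂ)⁻¹) • ξ with hη_def
  have : Nonempty X := ⟨⟨0, hX⟩⟩
  have h1 : ⨅ S : X, ‖T η - S.1 η‖ ≤ arveson T X := by
    refine le_ciSup (f := fun ζ : {ζ : H // ‖ζ‖ = 1} => ⨅ S : X, ‖T ζ.1 - S.1 ζ.1‖)
      ⟨‖T‖, ?_⟩ ⟨η, hη⟩
    rintro _ ⟨ζ, rfl⟩
    refine (ciInf_le (bddBelow_range_norm_sub T X ζ.1) ⟨0, hX⟩).trans ?_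
    simpa [ζ.2] using T.le_opNorm ζ.1
  obtain ⟨S, hS⟩ := exists_lt_of_ciInf_lt (h1.trans_lt (lt_add_of_pos_right _ hε))
  refine ⟨S.1, S.2, ?_⟩
  have h2 : ‖ξ‖ * ‖T η - S.1 η‖ = ‖T ξ - S.1 ξ‖ := by
    rw [hη_def, map_smul, map_smul, ← smul_sub, norm_smul, norm_inv, Complex.norm_real, norm_norm,
      mul_inv_cancel_left₀ (norm_ne_zero_iff.2 hξ)]
  rw [← h2, mul_comm]
  gcongr

theorem norm_sum_sq_of_pairwise {ι : Type*} (s : Finset ι) (x : ι → H)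
    (h : ∀ i ∈ s, ∀ j ∈ s, i ≠ j → ⟪x i, x j⟫_ℂ = 0) :
    ‖∑ i ∈ s, x i‖ ^ 2 = ∑ i ∈ s, ‖x i‖ ^ 2 := by
  rw [@norm_sq_eq_re_inner ℂ, sum_inner, map_sum]
  refine Finset.sum_congr rfl fun i hi => ?_
  rw [inner_sum, Finset.sum_eq_single_of_mem i hi fun j hj hji => h i hi j hj hji.symm,
    @norm_sq_eq_re_inner ℂ]

theorem inner_apply_apply_of_mul_eq_zero {p q : B H} (hp : IsStarProjection p) (hpq : p * q = 0)
    (x y : H) : ⟪p x, q y⟫_ℂ = 0 := by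
  rw [← ContinuousLinearMap.adjoint_inner_right, ← ContinuousLinearMap.star_eq_adjoint,
    hp.isSelfAdjoint.star_eq, ← mul_apply_eq_comp, hpq, zero_apply, inner_zero_right]

namespace IsBlockSet

variable {K : Finset (B H × B H)}

theorem sum_norm_right_apply_sq_le (hD : IsMasa D) (h : IsBlockSet D Sig K) (ξ : H) :
    ∑ k ∈ K, ‖k.2 ξ‖ ^ 2 ≤ ‖ξ‖ ^ 2 := by
  rw [← norm_sum_sq_of_pairwise K _ fun i hi j hj hij => inner_apply_apply_of_mul_eq_zero
    (h i hi).right ((h i hi).right_mul_right_eq_zero hD (h j hj) hij) ξ ξ, ← sum_apply]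
  have h1 := (∑ k ∈ K, k.2).le_of_opNorm_le (h.isStarProjection_sum_right hD).norm_le ξ
  rw [one_mul] at h1
  gcongr

theorem norm_sum_left_apply_le (hD : IsMasa D) (h : IsBlockSet D Sig K) (y : B H × B H → H)
    {c : ℝ} (hc : 0 ≤ c) (ξ : H) (hy : ∀ k ∈ K, ‖y k‖ ≤ c * ‖k.2 ξ‖) :
    ‖∑ k ∈ K, k.1 (y k)‖ ≤ c * ‖ξ‖ := by
  rw [← sq_le_sq₀ (norm_nonneg _) (by positivity), norm_sum_sq_of_pairwise K _
    fun i hi j hj hij => inner_apply_apply_of_mul_eq_zero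
      (h i hi).left ((h i hi).left_mul_left_eq_zero hD (h j hj) hij) _ _]
  calc ∑ k ∈ K, ‖k.1 (y k)‖ ^ 2 ≤ ∑ k ∈ K, c ^ 2 * ‖k.2 ξ‖ ^ 2 := by
        refine Finset.sum_le_sum fun k hk => ?_
        rw [← mul_pow]
        have h1 := k.1.le_of_opNorm_le (h k hk).left.norm_le (y k)
        rw [one_mul] at h1
        gcongr
        exact h1.trans (hy k hk)
    _ ≤ (c * ‖ξ‖) ^ 2 := by
        rw [← Finset.mul_sum, mul_pow]
        gcongr
        exact h.sum_norm_right_apply_sq_le hD ξ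

end IsBlockSet

theorem arveson_map_le (hD : IsMasa D) {Φ : B H →L[ℂ] B H} (hΦ : IsSchurIdempotent D Φ)
    (hS : IsSchurIdempotent D Sig) (hc : ‖Sig‖ ≤ 1) (T : B H) :
    arveson (Sig T) (Set.range Φ) ≤ arveson T (Set.range (ContinuousLinearMap.id ℂ (B H) -
      (ContinuousLinearMap.id ℂ (B H) - Φ).comp Sig)) := by
  set Ψ := ContinuousLinearMap.id ℂ (B H) - (ContinuousLinearMap.id ℂ (B H) - Φ).comp Sig with hΨ
  set α := arveson T (Set.range Ψ)
  have hα : 0 ≤ α := arveson_nonneg _ _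
  refine arveson_le hα fun ξ hξ ε hε => ?_
  set δ := ε / (‖Sig T‖ + 1) with hδ
  have hδ0 : 0 < δ := by positivity
  obtain ⟨K, hK, hKξ⟩ := exists_norm_blockProj_sub_le hD Sig ξ hδ0
  have hX : ∀ k : B H × B H, ∃ Y, ‖T (k.2 ξ) - Ψ Y (k.2 ξ)‖ ≤ (α + δ) * ‖k.2 ξ‖ := fun k => by
    obtain ⟨_, ⟨Y, rfl⟩, hY⟩ := exists_norm_sub_le_arveson T (X := Set.range Ψ) ⟨0, map_zero _⟩
      (k.2 ξ) hδ0
    exact ⟨Y, hY⟩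
  choose Y hY using hX
  refine ⟨Φ (∑ k ∈ K, k.1 * Y k * k.2), ⟨_, rfl⟩, ?_⟩
  have hblock : ∀ k ∈ K, Φ (k.1 * Y k * k.2) = k.1 * Ψ (Y k) * k.2 := fun k hk => by
    have h1 := (hK k hk).mul_apply (Y k)
    have h2 := (hK k hk).right.isIdempotentElem.eq
    have h3 : k.1 * Sig (Y k) * k.2 = k.1 * Y k * k.2 := by rw [h1, mul_assoc, h2]
    have h4 : k.1 * Φ (Sig (Y k)) * k.2 = Φ (k.1 * Y k * k.2) := by
      rw [← (hK k hk).map_mul_mul hΦ, h3]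
    simp only [hΨ, sub_apply, ContinuousLinearMap.comp_apply, ContinuousLinearMap.id_apply,
      mul_sub, sub_mul, h3, h4]
    abel
  have hsum : Sig T ξ - Φ (∑ k ∈ K, k.1 * Y k * k.2) ξ =
      Sig T (blockProj hD Sig ξ - (∑ k ∈ K, k.2) ξ) +
        ∑ k ∈ K, k.1 (T (k.2 ξ) - Ψ (Y k) (k.2 ξ)) := by
    have h1 : Sig T ((∑ k ∈ K, k.2) ξ) = ∑ k ∈ K, k.1 (T (k.2 ξ)) := by
      rw [sum_apply, map_sum]
      exact Finset.sum_congr rfl fun k hk => DFunLike.congr_fun ((hK k hk).apply_mul T) ξ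
    have h2 : Φ (∑ k ∈ K, k.1 * Y k * k.2) ξ = ∑ k ∈ K, k.1 (Ψ (Y k) (k.2 ξ)) := by
      rw [map_sum, Finset.sum_congr rfl hblock, sum_apply]
      rfl
    have h3 : Sig T (blockProj hD Sig ξ) = Sig T ξ :=
      DFunLike.congr_fun (apply_mul_blockProj hD hS hc T) ξ
    simp only [map_sub, Finset.sum_sub_distrib, h1, h2, h3]
    abel
  rw [hsum]
  have h1 := hK.norm_sum_left_apply_le hD (fun k => T (k.2 ξ) - Ψ (Y k) (k.2 ξ))
    (by positivity) ξ fun k _ => hY k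
  rw [hξ, mul_one] at h1
  calc _ ≤ ‖Sig T‖ * δ + (α + δ) :=
        (norm_add_le _ _).trans (add_le_add ((Sig T).le_opNorm_of_le hKξ) h1)
    _ = α + δ * (‖Sig T‖ + 1) := by ring
    _ = α + ε := by rw [hδ, div_mul_cancel₀ _ (by positivity)]

theorem lamSet_subset (hD : IsMasa D) {Φ : B H →L[ℂ] B H} (hΦ : IsSchurIdempotent D Φ)
    (hS : IsSchurIdempotent D Sig) (hc : ‖Sig‖ ≤ 1) :
    lamSet Φ ⊆ lamSet (ContinuousLinearMap.id ℂ (B H) -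
      (ContinuousLinearMap.id ℂ (B H) - Φ).comp Sig) := by
  rintro l ⟨hl, h⟩
  refine ⟨hl, fun T => ?_⟩
  calc _ = ‖Sig T - Φ (Sig T)‖ := by simp
    _ ≤ l * arveson (Sig T) (Set.range Φ) := h (Sig T)
    _ ≤ _ := by
      gcongr
      exact arveson_map_le hD hΦ hS hc T

end SchurHyper

/-- if `Φ ∈ 𝔉H` and `Σ` is a contractive Schur idempotent, then
`Ψ = id − (id − Φ)∘Σ` belongs to `𝔉H` and `λ(Ψ) ≤ λ(Φ)`. -/
theorem stmt3 {H : Type*} [NormedAddCommGroup H] [InnerProductSpace ℂ H] [CompleteSpace H]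
    [TopologicalSpace.SeparableSpace H]
    (D : StarSubalgebra ℂ (B H)) (hD : IsMasa D)
    (Φ : B H →L[ℂ] B H) (hΦ : MemFH D Φ)
    (Sig : B H →L[ℂ] B H) (hSig : IsSchurIdempotent D Sig) (hSigc : ‖Sig‖ ≤ 1) :
    MemFH D (ContinuousLinearMap.id ℂ (B H) -
        (ContinuousLinearMap.id ℂ (B H) - Φ).comp Sig) ∧
    lam (ContinuousLinearMap.id ℂ (B H) -
        (ContinuousLinearMap.id ℂ (B H) - Φ).comp Sig) ≤ lam Φ := by
  have hsub := lamSet_subset hD hΦ.1 hSig hSigc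
  exact ⟨⟨hΦ.1.id_sub_comp hD hSig hSigc, hΦ.2.mono hsub⟩,
    csInf_le_csInf ⟨0, fun l hl => hl.1.le⟩ hΦ.2 hsub⟩
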